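/- Let T be a Y(2|1) T-family in A, let M be a left A-module with highest weight vector Ω, and let ū = (u₁,…,u_a), v̄ = (v₁,…,v_b) have admissible concatenation. Define Φ_{a,b}(ū,v̄) = Σ g(v̄_I,ū_I)·f(ū_I,ū_II)·g(v̄_II,v̄_I)·h(ū_I,ū_I)·λ₂(v̄_I)·𝕋₁₃(ū_I)·T₁₂(ū_II)·𝕋₂₃(v̄_II)·Ω (sum over partitions with #ū_I = #v̄_I). Suppose the Bethe equations hold: λ₁(uⱼ)·f(ūⱼ,uⱼ) = λ₂(uⱼ)·f(uⱼ,ūⱼ)·f(v̄,uⱼ) for all j = 1,…,a, and λ₃(vⱼ) = λ₂(vⱼ)·f(vⱼ,ū) for all j = 1,…,b. Then for every z ∈ ℂ such that (z,u₁,…,u_a,v₁,…,v_b) is admissible, the graded transfer matrix t(z) = T₁₁(z) + T₂₂(z) − T₃₃(z) satisfies t(z)·Φ_{a,b}(ū,v̄) = τ(z|ū,v̄)·Φ_{a,b}(ū,v̄), where τ(z|ū,v̄) = λ₁(z)·f(ū,z) + λ₂(z)·f(z,ū)·f(v̄,z) − λ₃(z)·f(v̄,z). -/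

import Mathlib

open scoped BigOperators
open MulOpposite

noncomputable section

namespace Bethe

variable {A : Type*} [Ring A] [Algebra ℂ A]

/-- `g(u,v) = c/(u-v)` -/
def gg (c u v : ℂ) : ℂ := c / (u - v)

/-- `f(u,v) = (u-v+c)/(u-v)` -/
def ff (c u v : ℂ) : ℂ := (u - v + c) / (u - v)

/-- `h(u,v) = (u-v+c)/c` -/
def hh (c u v : ℂ) : ℂ := (u - v + c) / c

/-- A list of parameters is admissible if its entries are pairwise distinct and
`x - y + c ≠ 0` for any two distinct entries `x`, `y`. -/
def Admissible (c : ℂ) (l : List ℂ) : Prop :=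
  l.Pairwise fun x y => x ≠ y ∧ x - y + c ≠ 0 ∧ y - x + c ≠ 0

/-- `∏_{x ∈ xs} ∏_{y ∈ ys} f(x,y)` -/
def prodFF (c : ℂ) (xs ys : List ℂ) : ℂ :=
  (xs.map fun x => (ys.map fun y => ff c x y).prod).prod

/-- `∏_{x ∈ xs} ∏_{y ∈ ys} g(x,y)` -/
def prodGG (c : ℂ) (xs ys : List ℂ) : ℂ :=
  (xs.map fun x => (ys.map fun y => gg c x y).prod).prod

/-- `∏_{x ∈ xs} ∏_{y ∈ ys} h(x,y)` -/
def prodHH (c : ℂ) (xs ys : List ℂ) : ℂ :=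
  (xs.map fun x => (ys.map fun y => hh c x y).prod).prod

/-- `H(w̄) = ∏_{j>k} h(wⱼ,wₖ)` -/
def Hnorm (c : ℂ) : List ℂ → ℂ
  | [] => 1
  | x :: xs => ((xs.map fun y => hh c y x).prod) * Hnorm c xs

/-- `H(w̄*) = ∏_{j<k} h(wⱼ,wₖ)` -/
def HnormRev (c : ℂ) : List ℂ → ℂ
  | [] => 1
  | x :: xs => ((xs.map fun y => hh c x y).prod) * HnormRev c xs

/-- product of `h` over ordered pairs of distinct positions of a list -/
def prodHHne (c : ℂ) (xs : List ℂ) : ℂ :=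
  ∏ j : Fin xs.length, ∏ k : Fin xs.length,
    if j ≠ k then hh c (xs.get j) (xs.get k) else 1

/-- ordered product `T(w₁)⋯T(wₙ)` -/
def Tprod (Tij : ℂ → A) (l : List ℂ) : A := (l.map Tij).prod

/-- normalized ordered product `H(w̄)⁻¹ T(w₁)⋯T(wₙ)` -/
def TT (c : ℂ) (Tij : ℂ → A) (l : List ℂ) : A := (Hnorm c l)⁻¹ • Tprod Tij l

/-- normalized ordered product `H(w̄*)⁻¹ T(w₁)⋯T(wₙ)` -/
def TTrev (c : ℂ) (Tij : ℂ → A) (l : List ℂ) : A := (HnormRev c l)⁻¹ • Tprod Tij l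

/-- The defining (RTT) commutation relations of a super-Yangian `T`-family with
`ℤ₂`-grading `p`. -/
def IsTFam (c : ℂ) {N : ℕ} (p : Fin N → ℕ) (T : Fin N → Fin N → ℂ → A) : Prop :=
  ∀ i j k l : Fin N, ∀ z w : ℂ, z ≠ w →
    T i j z * T k l w - ((-1 : ℂ) ^ ((p i + p j) * (p k + p l))) • (T k l w * T i j z)
      = ((-1 : ℂ) ^ (p l * (p i + p j) + p i * p j) * gg c z w) •
          (T i l z * T k j w - T i l w * T k j z)

/-- the distinguished grading of `gl(2|1)`: `[1]=[2]=0`, `[3]=1` -/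
def p21 : Fin 3 → ℕ := ![0, 0, 1]

/-- the distinguished grading of `gl(1|2)`: `[1]=0`, `[2]=[3]=1` -/
def p12 : Fin 3 → ℕ := ![0, 1, 1]

/-- the sublist of `l` given by the positions in `S`, in the inherited order -/
def sel (l : List ℂ) (S : Finset (Fin l.length)) : List ℂ :=
  (S.sort (· ≤ ·)).map l.get

/-- `λ(w̄) = ∏ⱼ λ(wⱼ)` -/
def lamP (lam2 : ℂ → ℂ) (l : List ℂ) : ℂ := (l.map lam2).prod

/-- The Izergin kernel `K_ℓ(v̄|ū)`. -/
def Kiz (c : ℂ) {ℓ : ℕ} (vs us : Fin ℓ → ℂ) : ℂ :=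
  (∏ j : Fin ℓ, ∏ k : Fin ℓ, if (k : ℕ) < (j : ℕ) then gg c (vs j) (vs k) else 1) *
    (∏ j : Fin ℓ, ∏ k : Fin ℓ, if (k : ℕ) < (j : ℕ) then gg c (us k) (us j) else 1) *
    (∏ j : Fin ℓ, ∏ k : Fin ℓ, hh c (vs j) (us k)) *
    Matrix.det (Matrix.of fun j k => gg c (vs j) (us k) / hh c (vs j) (us k))

/-- The Izergin kernel for lists of equal length (and junk value `0` otherwise). -/
def KizL (c : ℂ) (vs us : List ℂ) : ℂ :=
  if h : vs.length = us.length then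
    Kiz c vs.get fun j => us.get (Fin.cast h j)
  else 0

/-- The operator `X_{a,b}(ū,v̄)` of the paper (`Y(2|1)` case). -/
def X (c : ℂ) (T : Fin 3 → Fin 3 → ℂ → A) (u v : List ℂ) : A :=
  ∑ S : Finset (Fin u.length), ∑ Q : Finset (Fin v.length),
    if S.card = Q.card then
      (prodGG c (sel v Q) (sel u S) * prodFF c (sel u S) (sel u Sᶜ) *
          prodGG c (sel v Qᶜ) (sel v Q) * prodHHne c (sel u S)) •
        (TT c (T 0 2) (sel u S) * Tprod (T 0 1) (sel u Sᶜ) *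
          TT c (T 1 2) (sel v Qᶜ) * Tprod (T 1 1) (sel v Q))
    else 0

/-- The operator `Y_{a,b}(ū,v̄)` of the paper (`Y(2|1)` case). -/
def Y (c : ℂ) (T : Fin 3 → Fin 3 → ℂ → A) (u v : List ℂ) : A :=
  ∑ S : Finset (Fin u.length), ∑ Q : Finset (Fin v.length),
    if S.card = Q.card then
      (KizL c (sel v Q) (sel u S) * prodFF c (sel u S) (sel u Sᶜ) *
          prodGG c (sel v Qᶜ) (sel v Q)) •
        (TT c (T 0 2) (sel v Q) * TT c (T 1 2) (sel v Qᶜ) *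
          Tprod (T 0 1) (sel u Sᶜ) * Tprod (T 1 1) (sel u S))
    else 0

/-- First explicit expression for the `Y(2|1)` Bethe vector (operator part,
the weights `λ₂` included as scalars). -/
def PhiA (c : ℂ) (T : Fin 3 → Fin 3 → ℂ → A) (lam2 : ℂ → ℂ) (u v : List ℂ) : A :=
  ∑ S : Finset (Fin u.length), ∑ Q : Finset (Fin v.length),
    if S.card = Q.card then
      (prodGG c (sel v Q) (sel u S) * prodFF c (sel u S) (sel u Sᶜ) *
          prodGG c (sel v Qᶜ) (sel v Q) * prodHHne c (sel u S) * lamP lam2 (sel v Q)) •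
        (TT c (T 0 2) (sel u S) * Tprod (T 0 1) (sel u Sᶜ) * TT c (T 1 2) (sel v Qᶜ))
    else 0

/-- Second explicit expression for the `Y(2|1)` Bethe vector (operator part). -/
def PhiB (c : ℂ) (T : Fin 3 → Fin 3 → ℂ → A) (lam2 : ℂ → ℂ) (u v : List ℂ) : A :=
  ∑ S : Finset (Fin u.length), ∑ Q : Finset (Fin v.length),
    if S.card = Q.card then
      (KizL c (sel v Q) (sel u S) * prodFF c (sel u S) (sel u Sᶜ) *
          prodGG c (sel v Qᶜ) (sel v Q) * lamP lam2 (sel u S)) •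
        (TT c (T 0 2) (sel v Q) * TT c (T 1 2) (sel v Qᶜ) * Tprod (T 0 1) (sel u Sᶜ))
    else 0

/-- First explicit expression for the `Y(1|2)` Bethe vector, without the overall
sign `(-1)^b` (operator part). -/
def PhiTA (c : ℂ) (T : Fin 3 → Fin 3 → ℂ → A) (lam2 : ℂ → ℂ) (u v : List ℂ) : A :=
  ∑ S : Finset (Fin u.length), ∑ Q : Finset (Fin v.length),
    if S.card = Q.card then
      (prodGG c (sel u S) (sel v Q) * prodFF c (sel v Q) (sel v Qᶜ) *
          prodGG c (sel u Sᶜ) (sel u S) * prodHHne c (sel v Q) * lamP lam2 (sel u S)) •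
        (TT c (T 0 2) (sel v Q) * Tprod (T 1 2) (sel v Qᶜ) * TT c (T 0 1) (sel u Sᶜ))
    else 0

/-- Second explicit expression for the `Y(1|2)` Bethe vector, without the overall
sign `(-1)^b` (operator part). -/
def PhiTB (c : ℂ) (T : Fin 3 → Fin 3 → ℂ → A) (lam2 : ℂ → ℂ) (u v : List ℂ) : A :=
  ∑ S : Finset (Fin u.length), ∑ Q : Finset (Fin v.length),
    if S.card = Q.card then
      (KizL c (sel u S) (sel v Q) * prodFF c (sel v Q) (sel v Qᶜ) *
          prodGG c (sel u Sᶜ) (sel u S) * lamP lam2 (sel v Q)) •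
        (TT c (T 0 2) (sel u S) * TT c (T 0 1) (sel u Sᶜ) * Tprod (T 1 2) (sel v Qᶜ))
    else 0

/-- First explicit expression for the dual `Y(2|1)` Bethe vector, without the
overall sign `(-1)^{b(b-1)/2}`.  `E` is a right `A`-module, i.e. a left
`Aᵐᵒᵖ`-module; `op X • Ωd` is `Ωd · X`. -/
def PsiA {E : Type*} [AddCommGroup E] [Module ℂ E] [Module Aᵐᵒᵖ E]
    (c : ℂ) (T : Fin 3 → Fin 3 → ℂ → A) (lam2 : ℂ → ℂ) (u v : List ℂ) (Ωd : E) : E :=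
  ∑ S : Finset (Fin u.length), ∑ Q : Finset (Fin v.length),
    if S.card = Q.card then
      (prodGG c (sel v Q) (sel u S) * prodFF c (sel u S) (sel u Sᶜ) *
          prodGG c (sel v Qᶜ) (sel v Q) * prodHHne c (sel u S) * lamP lam2 (sel v Q)) •
        (op (TTrev c (T 2 1) (sel v Qᶜ) * Tprod (T 1 0) (sel u Sᶜ) *
              TTrev c (T 2 0) (sel u S)) • Ωd)
    else 0

/-- The dual `Y(2|1)` Bethe vector `Ψ_{a,b}(ū,v̄)`. -/
def Psi {E : Type*} [AddCommGroup E] [Module ℂ E] [Module Aᵐᵒᵖ E]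
    (c : ℂ) (T : Fin 3 → Fin 3 → ℂ → A) (lam2 : ℂ → ℂ) (u v : List ℂ) (Ωd : E) : E :=
  ((-1 : ℂ) ^ (v.length * (v.length - 1) / 2)) • PsiA c T lam2 u v Ωd

/-- Second explicit expression for the dual `Y(2|1)` Bethe vector, without the
overall sign `(-1)^{b(b-1)/2}`. -/
def PsiB {E : Type*} [AddCommGroup E] [Module ℂ E] [Module Aᵐᵒᵖ E]
    (c : ℂ) (T : Fin 3 → Fin 3 → ℂ → A) (lam2 : ℂ → ℂ) (u v : List ℂ) (Ωd : E) : E :=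
  ∑ S : Finset (Fin u.length), ∑ Q : Finset (Fin v.length),
    if S.card = Q.card then
      (KizL c (sel v Q) (sel u S) * prodFF c (sel u S) (sel u Sᶜ) *
          prodGG c (sel v Qᶜ) (sel v Q) * lamP lam2 (sel u S)) •
        (op (Tprod (T 1 0) (sel u Sᶜ) * TTrev c (T 2 1) (sel v Qᶜ) *
              TTrev c (T 2 0) (sel v Q)) • Ωd)
    else 0

set_option linter.all false

section Nested

variable {M : Type*} [AddCommGroup M] [Module ℂ M]

/-- words in the two letters `2` (`false`) and `3` (`true`), with values in `M` -/
abbrev LL (M : Type*) := List Bool → M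

/-- sign attached to a parity -/
def sgn : Bool → ℂ
  | false => 1
  | true => -1

@[simp] lemma sgn_false : sgn false = 1 := rfl
@[simp] lemma sgn_true : sgn true = -1 := rfl

/-- component of a word function -/
def hd (d : Bool) : LL M →ₗ[ℂ] LL M := LinearMap.funLeft ℂ M (fun l => d :: l)

@[simp] lemma hd_apply (d : Bool) (F : LL M) (l : List Bool) : hd d F l = F (d :: l) := rfl

/-- residue operator -/
def Yop (D : Bool → Bool → Module.End ℂ (LL M)) (a : Bool) : LL M →ₗ[ℂ] LL M :=
  D a false ∘ₗ hd false + sgn a • (D a true ∘ₗ hd true)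

lemma Yop_apply (D : Bool → Bool → Module.End ℂ (LL M)) (a : Bool) (F : LL M) :
    Yop D a F = D a false (hd false F) + sgn a • D a true (hd true F) := rfl

/-- one dressing step -/
def stp (c u z : ℂ) (D : Bool → Bool → Module.End ℂ (LL M)) (a b : Bool) :
    Module.End ℂ (LL M) where
  toFun F := fun l => match l with
    | [] => 0
    | d :: l => sgn (d && (a ^^ b)) • D a b (hd d F) l +
        (if d = b then gg c z u else 0) • Yop D a F l
  map_add' F G := by
    funext l
    cases l with
    | nil => simp
    | cons d l => simp only [map_add, Pi.add_apply]; module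
  map_smul' r F := by
    funext l
    cases l with
    | nil => simp
    | cons d l => simp only [map_smul, Pi.smul_apply, RingHom.id_apply]; module

@[simp] lemma stp_nil (c u z : ℂ) (D : Bool → Bool → Module.End ℂ (LL M)) (a b : Bool)
    (F : LL M) : stp c u z D a b F [] = 0 := rfl

lemma hd_stp (c u z : ℂ) (D : Bool → Bool → Module.End ℂ (LL M)) (a b d : Bool)
    (F : LL M) : hd d (stp c u z D a b F) = sgn (d && (a ^^ b)) • D a b (hd d F) +
        (if d = b then gg c z u else 0) • Yop D a F := rfl

lemma LL_ext {F G : LL M} (h0 : F [] = G []) (h : ∀ d, hd d F = hd d G) : F = G := by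
  funext l
  cases l with
  | nil => exact h0
  | cons d l => exact congrFun (h d) l

/-- the index of a letter -/
def ix : Bool → Fin 3
  | false => 1
  | true => 2

@[simp] lemma ix_false : ix false = 1 := rfl
@[simp] lemma ix_true : ix true = 2 := rfl

variable (c : ℂ) (t : Fin 3 → Fin 3 → ℂ → Module.End ℂ M)

/-- the dressed `gl(1|1)` family -/
def Dr : List ℂ → ℂ → Bool → Bool → Module.End ℂ (LL M)
  | [], z => fun a b => (t (ix a) (ix b) z).compLeft (List Bool)
  | u :: us, z => fun a b => stp c u z (Dr us z) a b

/-- pointwise action of `T₁₁` -/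
def T11p (z : ℂ) : Module.End ℂ (LL M) := (t 0 0 z).compLeft (List Bool)

@[simp] lemma T11p_apply (z : ℂ) (F : LL M) (l : List Bool) : T11p t z F l = t 0 0 z (F l) := rfl

lemma hd_T11p (z : ℂ) (d : Bool) (F : LL M) : hd d (T11p t z F) = T11p t z (hd d F) := rfl

/-- contraction with the creation operators `T₁₂`, `T₁₃` -/
def BB : List ℂ → (LL M →ₗ[ℂ] M)
  | [] => LinearMap.proj []
  | u :: us => t 0 1 u ∘ₗ BB us ∘ₗ hd false + t 0 2 u ∘ₗ BB us ∘ₗ hd true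

lemma BB_nil (F : LL M) : BB t [] F = F [] := rfl
lemma BB_cons (u : ℂ) (us : List ℂ) (F : LL M) :
    BB t (u :: us) F = t 0 1 u (BB t us (hd false F)) + t 0 2 u (BB t us (hd true F)) := rfl

/-- one exchange step -/
def Rsw (c u w : ℂ) (P : LL M →ₗ[ℂ] LL M) : LL M →ₗ[ℂ] LL M where
  toFun F := fun l => match l with
    | a :: d :: l => (ff c u w)⁻¹ • (sgn (a && d) • P (hd d F) (a :: l) +
        gg c u w • P (hd a F) (d :: l))
    | _ => 0
  map_add' F G := by
    funext l
    rcases l with _ | ⟨a, _ | ⟨d, l⟩⟩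
    · simp
    · simp
    · simp only [map_add, Pi.add_apply]; module
  map_smul' r F := by
    funext l
    rcases l with _ | ⟨a, _ | ⟨d, l⟩⟩
    · simp
    · simp
    · simp only [map_smul, Pi.smul_apply, RingHom.id_apply]; module

/-- move the `j`-th parameter to the front -/
def Pm : List ℂ → ℕ → (LL M →ₗ[ℂ] LL M)
  | [], _ => LinearMap.id
  | _ :: _, 0 => LinearMap.id
  | u :: us, j + 1 => Rsw c u (us.getD j 0) (Pm us j)

lemma hd_Rsw (u w : ℂ) (P : LL M →ₗ[ℂ] LL M) (a d : Bool) (F : LL M) :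
    hd d (hd a (Rsw c u w P F)) = (ff c u w)⁻¹ • (sgn (a && d) • hd a (P (hd d F)) +
        gg c u w • hd d (P (hd a F))) := rfl

/-- two parameters in general position -/
def Nice (c x y : ℂ) : Prop := x ≠ y ∧ x - y + c ≠ 0 ∧ y - x + c ≠ 0

variable {c t}

lemma Nice.symm {x y : ℂ} (h : Nice c x y) : Nice c y x := ⟨h.1.symm, h.2.2, h.2.1⟩


lemma rel_app (ht : IsTFam c p21 t) (i j k l : Fin 3) {z w : ℂ} (h : z ≠ w) (x : M) :
    t i j z (t k l w x) - ((-1 : ℂ) ^ ((p21 i + p21 j) * (p21 k + p21 l))) • (t k l w (t i j z x))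
      = ((-1 : ℂ) ^ (p21 l * (p21 i + p21 j) + p21 i * p21 j) * gg c z w) •
          (t i l z (t k j w x) - t i l w (t k j z x)) := by
  have := congrArg (fun e : Module.End ℂ M => e x) (ht i j k l z w h)
  simpa using this

/-- `T₁₁` against a creation operator -/
lemma t00_cr (ht : IsTFam c p21 t) (a : Bool) {z u : ℂ} (h : z ≠ u) (x : M) :
    t 0 0 z (t 0 (ix a) u x) = ff c u z • t 0 (ix a) u (t 0 0 z x) +
      gg c z u • t 0 (ix a) z (t 0 0 u x) := by
  have h1 := rel_app ht 0 0 0 (ix a) h x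
  have hzu : z - u ≠ 0 := sub_ne_zero.2 h
  have huz : u - z ≠ 0 := sub_ne_zero.2 h.symm
  have e : ff c u z = 1 - gg c z u := by unfold ff gg; field_simp; ring
  rw [e]
  cases a <;> simp [p21] at h1 ⊢ <;> linear_combination (norm := module) h1

/-- exchange of creation operators -/
lemma cr_cr (ht : IsTFam c p21 t) (a d : Bool) {z u : ℂ} (h : z ≠ u) (x : M) :
    ff c u z • t 0 (ix a) u (t 0 (ix d) z x) = sgn (a && d) • t 0 (ix d) z (t 0 (ix a) u x) +
      gg c u z • t 0 (ix a) z (t 0 (ix d) u x) := by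
  have h1 := rel_app ht 0 (ix d) 0 (ix a) h x
  have hzu : z - u ≠ 0 := sub_ne_zero.2 h
  have huz : u - z ≠ 0 := sub_ne_zero.2 h.symm
  have e : ff c u z = 1 - gg c z u := by unfold ff gg; field_simp; ring
  have e' : gg c u z = - gg c z u := by unfold gg; field_simp; ring
  rw [e, e']
  cases a <;> cases d <;> simp [p21] at h1 ⊢
  · linear_combination (norm := module) (-1 : ℂ) • h1
  · linear_combination (norm := module) (-1 : ℂ) • h1
  · linear_combination (norm := module) (-1 : ℂ) • h1
  · linear_combination (norm := module) (1 : ℂ) • h1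

/-- the `gl(1|1)` block against a creation operator -/
lemma D_cr (ht : IsTFam c p21 t) (a b d : Bool) {z u : ℂ} (h : z ≠ u) (x : M) :
    t (ix a) (ix b) z (t 0 (ix d) u x) =
      sgn (d && (a ^^ b)) • t 0 (ix d) u (t (ix a) (ix b) z x)
      + (sgn (a && d) * gg c z u) • (t 0 (ix b) u (t (ix a) (ix d) z x)
          - t 0 (ix b) z (t (ix a) (ix d) u x)) := by
  have h1 := rel_app ht 0 (ix d) (ix a) (ix b) h.symm x
  have hzu : z - u ≠ 0 := sub_ne_zero.2 h
  have huz : u - z ≠ 0 := sub_ne_zero.2 h.symm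
  have e' : gg c u z = - gg c z u := by unfold gg; field_simp; ring
  rw [e'] at h1
  cases a <;> cases b <;> cases d <;> simp [p21] at h1 ⊢
  all_goals first
    | linear_combination (norm := module) (-1 : ℂ) • h1
    | linear_combination (norm := module) (1 : ℂ) • h1

end Nested


section Nested2

variable {M : Type*} [AddCommGroup M] [Module ℂ M]
variable {c : ℂ} {t : Fin 3 → Fin 3 → ℂ → Module.End ℂ M}

lemma prodFF_cons_sing (u : ℂ) (us : List ℂ) (z : ℂ) :
    prodFF c (u :: us) [z] = ff c u z * prodFF c us [z] := by
  simp [prodFF]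

lemma prodFF_sing_cons (u : ℂ) (us : List ℂ) (z : ℂ) :
    prodFF c [z] (u :: us) = ff c z u * prodFF c [z] us := by
  simp [prodFF]

@[simp] lemma prodFF_nil_sing (z : ℂ) : prodFF c [] [z] = 1 := by simp [prodFF]
@[simp] lemma prodFF_sing_nil (z : ℂ) : prodFF c [z] [] = 1 := by simp [prodFF]

lemma Nice.sub_ne {x y : ℂ} (h : Nice c x y) : x - y ≠ 0 := sub_ne_zero.2 h.1
lemma Nice.ff_ne {x y : ℂ} (h : Nice c x y) : ff c x y ≠ 0 :=
  div_ne_zero h.2.1 h.sub_ne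

/-- the `j`-th unwanted term of `T₁₁` -/
def unwA (c : ℂ) (t : Fin 3 → Fin 3 → ℂ → Module.End ℂ M) (us : List ℂ) (z : ℂ) (F : LL M)
    (j : Fin us.length) : M :=
  (gg c z (us.get j) * prodFF c (us.eraseIdx j) [us.get j]) •
    (t 0 1 z (BB t (us.eraseIdx j) (T11p t (us.get j) (hd false (Pm c us j F)))) +
     t 0 2 z (BB t (us.eraseIdx j) (T11p t (us.get j) (hd true (Pm c us j F)))))

lemma unwA_step (ht : IsTFam c p21 t) (u0 : ℂ) (us : List ℂ) (z : ℂ) (F : LL M)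
    (j : Fin us.length) (hzu : z ≠ u0) (hzw : z ≠ us.get j) (hw : Nice c u0 (us.get j)) :
    ff c u0 z • t 0 1 u0 (unwA c t us z (hd false F) j) +
    gg c z u0 • t 0 1 z (unwA c t us u0 (hd false F) j) +
    ff c u0 z • t 0 2 u0 (unwA c t us z (hd true F) j) +
    gg c z u0 • t 0 2 z (unwA c t us u0 (hd true F) j) =
    unwA c t (u0 :: us) z F j.succ := by
  have hP : Pm c (u0 :: us) (j.succ : ℕ) = Rsw (M := M) c u0 (us.get j) (Pm c us j) := by
    simp [Pm]
  unfold unwA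
  rw [hP]
  simp only [Fin.val_succ, List.get_cons_succ', List.eraseIdx_cons_succ, BB_cons, hd_T11p,
    prodFF_cons_sing, hd_Rsw, map_add, map_smul]
  set w := us.get j with hwdef
  set r := us.eraseIdx j
  set p := prodFF c r [w]
  have e1 := fun a d x => cr_cr ht a d hzu x
  generalize BB t r (T11p t w (hd false (Pm c us j (hd false F)))) = x00
  generalize BB t r (T11p t w (hd false (Pm c us j (hd true F)))) = x01
  generalize BB t r (T11p t w (hd true (Pm c us j (hd false F)))) = x10
  generalize BB t r (T11p t w (hd true (Pm c us j (hd true F)))) = x11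
  have a1 := e1 false false x00
  have a2 := e1 false true x10
  have a3 := e1 true false x01
  have a4 := e1 true true x11
  have n1 : u0 - z ≠ 0 := sub_ne_zero.2 hzu.symm
  have n2 : z - w ≠ 0 := sub_ne_zero.2 hzw
  have n3 := hw.sub_ne
  have n4 := hw.2.1
  have n5 : z - u0 ≠ 0 := sub_ne_zero.2 hzu
  have key : gg c z w * gg c u0 z + gg c z u0 * gg c u0 w = gg c u0 w * gg c z w := by
    unfold gg; field_simp; ring
  have nf : ff c u0 w ≠ 0 := hw.ff_ne
  simp only [sgn_false, sgn_true, Bool.and_true, Bool.and_false, Bool.and_self, ix_false,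
    ix_true] at a1 a2 a3 a4 ⊢
  have inv : ff c u0 w * (ff c u0 w)⁻¹ = 1 := mul_inv_cancel₀ nf
  generalize (ff c u0 w)⁻¹ = q at *
  generalize ff c u0 w = q' at *
  generalize gg c u0 z = g1 at *
  generalize gg c z w = g2 at *
  generalize gg c z u0 = g3 at *
  generalize gg c u0 w = g4 at *
  linear_combination (norm := skip) (g2 * p) • (a1 + a2 + a3 + a4)
  match_scalars
  all_goals try ring1
  all_goals try linear_combination p * key - g2 * p * inv - g2 * p * g4 * inv
  all_goals try linear_combination p * key - g2 * p * g4 * inv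
  all_goals try linear_combination - g2 * p * inv
  all_goals try linear_combination p * key + g2 * p * inv - g2 * p * g4 * inv

lemma L1a (ht : IsTFam c p21 t) : ∀ (us : List ℂ) (z : ℂ), (∀ x ∈ us, z ≠ x) →
    us.Pairwise (Nice c) → ∀ F : LL M,
    t 0 0 z (BB t us F) = prodFF c us [z] • BB t us (T11p t z F) +
      ∑ j : Fin us.length, unwA c t us z F j := by
  intro us
  induction us with
  | nil => intro z _ _ F; simp [BB_nil]
  | cons u0 us ih =>
    intro z hz hus F
    rw [List.pairwise_cons] at hus
    have hzu : z ≠ u0 := hz u0 (by simp)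
    have hz' : ∀ x ∈ us, z ≠ x := fun x hx => hz x (by simp [hx])
    have hu' : ∀ x ∈ us, u0 ≠ x := fun x hx => (hus.1 x hx).1
    have hs : ff c u0 z • t 0 1 u0 (∑ j, unwA c t us z (hd false F) j) +
        gg c z u0 • t 0 1 z (∑ j, unwA c t us u0 (hd false F) j) +
        ff c u0 z • t 0 2 u0 (∑ j, unwA c t us z (hd true F) j) +
        gg c z u0 • t 0 2 z (∑ j, unwA c t us u0 (hd true F) j) =
        ∑ j : Fin us.length, unwA c t (u0 :: us) z F j.succ := by
      simp only [map_sum, Finset.smul_sum, ← Finset.sum_add_distrib]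
      refine Finset.sum_congr rfl fun j _ => unwA_step ht u0 us z F j hzu ?_ ?_
      · exact hz' _ (List.get_mem _ _)
      · exact hus.1 _ (List.get_mem _ _)
    have f0 := t00_cr ht false hzu (BB t us (hd false F))
    have f1 := t00_cr ht true hzu (BB t us (hd true F))
    rw [ih z hz' hus.2, ih u0 hu' hus.2] at f0 f1
    simp only [ix_false, ix_true] at f0 f1
    have h0 : unwA c t (u0 :: us) z F (0 : Fin (us.length + 1)) =
      (gg c z u0 * prodFF c us [u0]) • (t 0 1 z (BB t us (T11p t u0 (hd false F))) +
        t 0 2 z (BB t us (T11p t u0 (hd true F)))) := rfl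
    rw [BB_cons, map_add, f0, f1]
    rw [show (∑ j : Fin (u0 :: us).length, unwA c t (u0 :: us) z F j) =
      ∑ j : Fin (us.length + 1), unwA c t (u0 :: us) z F j from rfl, Fin.sum_univ_succ, h0, ← hs]
    rw [prodFF_cons_sing, BB_cons, hd_T11p, hd_T11p]
    simp only [map_add, map_smul]
    module

/-- the `j`-th unwanted term of the `gl(1|1)` block -/
def unwB (c : ℂ) (t : Fin 3 → Fin 3 → ℂ → Module.End ℂ M) (us : List ℂ) (z : ℂ) (a b : Bool)
    (F : LL M) (j : Fin us.length) : M :=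
  gg c z (us.get j) •
    t 0 (ix b) z (BB t (us.eraseIdx j)
      (Yop (Dr c t (us.eraseIdx j) (us.get j)) a (Pm c us j F)))

lemma hd_Yop_step (u0 : ℂ) (r : List ℂ) (w : ℂ) (hw : Nice c u0 w) (a d : Bool)
    (P : LL M →ₗ[ℂ] LL M) (F : LL M) :
    hd d (Yop (Dr c t (u0 :: r) w) a (Rsw c u0 w P F)) =
      (sgn (a && d) * ff c w u0) • Yop (Dr c t r w) a (P (hd d F)) := by
  have n3 := hw.sub_ne
  have n3' := hw.symm.sub_ne
  have n4 := hw.2.1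
  have hD : Dr c t (u0 :: r) w = stp c u0 w (Dr c t r w) := rfl
  rw [hD]
  simp only [Yop_apply, map_add, map_smul, hd_stp, hd_Rsw]
  cases a <;> cases d <;> simp [-smul_add]
  all_goals
    match_scalars <;> first | ring1 | (simp only [ff, gg]; field_simp; try ring1)

lemma unwB_step (ht : IsTFam c p21 t) (u0 : ℂ) (us : List ℂ) (z : ℂ) (a b : Bool) (F : LL M)
    (j : Fin us.length) (hzu : z ≠ u0) (hzw : z ≠ us.get j) (hw : Nice c u0 (us.get j)) :
    sgn (false && (a ^^ b)) • t 0 1 u0 (unwB c t us z a b (hd false F) j) +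
    sgn (true && (a ^^ b)) • t 0 2 u0 (unwB c t us z a b (hd true F) j) +
    gg c z u0 • (t 0 (ix b) u0 (unwB c t us z a false (hd false F) j)
      + sgn a • t 0 (ix b) u0 (unwB c t us z a true (hd true F) j)) -
    gg c z u0 • (t 0 (ix b) z (unwB c t us u0 a false (hd false F) j)
      + sgn a • t 0 (ix b) z (unwB c t us u0 a true (hd true F) j)) =
    unwB c t (u0 :: us) z a b F j.succ := by
  have hP : Pm c (u0 :: us) (j.succ : ℕ) = Rsw (M := M) c u0 (us.get j) (Pm c us j) := by
    simp [Pm]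
  unfold unwB
  rw [hP]
  simp only [Fin.val_succ, List.get_cons_succ', List.eraseIdx_cons_succ, BB_cons]
  rw [hd_Yop_step _ _ _ hw, hd_Yop_step _ _ _ hw]
  simp only [map_smul]
  set w := us.get j with hwdef
  set r := us.eraseIdx j
  generalize BB t r (Yop (Dr c t r w) a (Pm c us j (hd false F))) = x0
  generalize BB t r (Yop (Dr c t r w) a (Pm c us j (hd true F))) = x1
  have a1 := cr_cr ht b false hzu x0
  have a2 := cr_cr ht b true hzu x1
  have b1 := cr_cr ht false b hzu x0
  have b2 := cr_cr ht true b hzu x1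
  have n1 : u0 - z ≠ 0 := sub_ne_zero.2 hzu.symm
  have n2 : z - w ≠ 0 := sub_ne_zero.2 hzw
  have n3 := hw.sub_ne
  have n3' := hw.symm.sub_ne
  have n5 : z - u0 ≠ 0 := sub_ne_zero.2 hzu
  have a1 := cr_cr ht b false hzu.symm x0
  have a2 := cr_cr ht b true hzu.symm x1
  cases a <;> cases b <;> simp [-smul_add] at a1 a2 ⊢
  · linear_combination (norm := skip) (-gg c z w) • a1 - gg c z w • a2
    match_scalars <;> first | ring1 | (simp only [ff, gg]; field_simp; try ring1)
  · linear_combination (norm := skip) (-gg c z w) • a1 - gg c z w • a2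
    match_scalars <;> first | ring1 | (simp only [ff, gg]; field_simp; try ring1)
  · linear_combination (norm := skip) (-gg c z w) • a1 + gg c z w • a2
    match_scalars <;> first | ring1 | (simp only [ff, gg]; field_simp; try ring1)
  · linear_combination (norm := skip) (-gg c z w) • a1 + gg c z w • a2
    match_scalars <;> first | ring1 | (simp only [ff, gg]; field_simp; try ring1)

lemma L1b (ht : IsTFam c p21 t) : ∀ (us : List ℂ) (z : ℂ), (∀ x ∈ us, z ≠ x) →
    us.Pairwise (Nice c) → ∀ (a b : Bool) (F : LL M),
    t (ix a) (ix b) z (BB t us F) = BB t us (Dr c t us z a b F) -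
      ∑ j : Fin us.length, unwB c t us z a b F j := by
  intro us
  induction us with
  | nil => intro z _ _ a b F; simp [BB_nil]; rfl
  | cons u0 us ih =>
    intro z hz hus a b F
    rw [List.pairwise_cons] at hus
    have hzu : z ≠ u0 := hz u0 (by simp)
    have hz' : ∀ x ∈ us, z ≠ x := fun x hx => hz x (by simp [hx])
    have hu' : ∀ x ∈ us, u0 ≠ x := fun x hx => (hus.1 x hx).1
    have hs : sgn (false && (a ^^ b)) • t 0 1 u0 (∑ j, unwB c t us z a b (hd false F) j) +
      sgn (true && (a ^^ b)) • t 0 2 u0 (∑ j, unwB c t us z a b (hd true F) j) +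
      gg c z u0 • (t 0 (ix b) u0 (∑ j, unwB c t us z a false (hd false F) j)
        + sgn a • t 0 (ix b) u0 (∑ j, unwB c t us z a true (hd true F) j)) -
      gg c z u0 • (t 0 (ix b) z (∑ j, unwB c t us u0 a false (hd false F) j)
        + sgn a • t 0 (ix b) z (∑ j, unwB c t us u0 a true (hd true F) j)) =
        ∑ j : Fin us.length, unwB c t (u0 :: us) z a b F j.succ := by
      simp only [map_sum, Finset.smul_sum, ← Finset.sum_add_distrib, ← Finset.sum_sub_distrib]
      refine Finset.sum_congr rfl fun j _ => unwB_step ht u0 us z a b F j hzu ?_ ?_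
      · exact hz' _ (List.get_mem _ _)
      · exact hus.1 _ (List.get_mem _ _)
    have f0 := D_cr ht a b false hzu (BB t us (hd false F))
    have f1 := D_cr ht a b true hzu (BB t us (hd true F))
    rw [ih z hz' hus.2, ih z hz' hus.2, ih u0 hu' hus.2] at f0 f1
    simp only [ix_false, ix_true] at f0 f1
    have h0 : unwB c t (u0 :: us) z a b F (0 : Fin (us.length + 1)) =
      gg c z u0 • t 0 (ix b) z (BB t us (Yop (Dr c t us u0) a F)) := rfl
    rw [BB_cons, map_add, f0, f1]
    rw [show (∑ j : Fin (u0 :: us).length, unwB c t (u0 :: us) z a b F j) =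
      ∑ j : Fin (us.length + 1), unwB c t (u0 :: us) z a b F j from rfl,
      Fin.sum_univ_succ, h0, ← hs]
    have hD : Dr c t (u0 :: us) z = stp c u0 z (Dr c t us z) := rfl
    rw [BB_cons, hD, hd_stp, hd_stp]
    simp only [map_add, map_smul, Yop_apply, map_sub]
    cases a <;> cases b <;> simp [-smul_add] <;> module

end Nested2


section Nested3

variable {M : Type*} [AddCommGroup M] [Module ℂ M]
variable {c : ℂ} {t : Fin 3 → Fin 3 → ℂ → Module.End ℂ M}

/-- `gl(1|1)` exchange relations at a pair of points -/
def Rel (c z w : ℂ) (Dz Dw : Bool → Bool → Module.End ℂ (LL M)) : Prop :=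
  ∀ (a b e d : Bool) (F : LL M),
    Dz a b (Dw e d F) - sgn ((a ^^ b) && (e ^^ d)) • Dw e d (Dz a b F) =
      (sgn ((d && (a ^^ b)) ^^ (a && b)) * gg c z w) • (Dz a d (Dw e b F) - Dw a d (Dz e b F))

lemma Rel.sol {z w : ℂ} {Dz Dw : Bool → Bool → Module.End ℂ (LL M)} (h : Rel c z w Dz Dw)
    (hn : Nice c z w) (a b e d : Bool) (F : LL M) :
    Dz a b (Dw e d F) = (ff c z w * ff c w z)⁻¹ • (
      sgn ((a ^^ b) && (e ^^ d)) • Dw e d (Dz a b F)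
      + (sgn ((d && (a ^^ b)) ^^ (a && b)) * gg c z w) •
        (sgn ((a ^^ d) && (e ^^ b)) • Dw e b (Dz a d F) - Dw a d (Dz e b F))
      - (gg c z w * gg c z w) • Dw a b (Dz e d F)) := by
  have n1 := hn.sub_ne
  have n2 := hn.symm.sub_ne
  have n3 := hn.2.1
  have n4 := hn.2.2
  have h1 := h a b e d F
  have h2 := h a d e b F
  have hs : sgn ((b && (a ^^ d)) ^^ (a && d)) = sgn ((d && (a ^^ b)) ^^ (a && b)) := by
    cases a <;> cases b <;> cases d <;> rfl
  have hss : sgn ((d && (a ^^ b)) ^^ (a && b)) * sgn ((d && (a ^^ b)) ^^ (a && b)) = 1 := by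
    cases a <;> cases b <;> cases d <;> simp
  rw [hs] at h2
  have e : ff c z w * ff c w z = 1 - gg c z w * gg c z w := by
    unfold ff gg; field_simp; ring
  have hne : ff c z w * ff c w z ≠ 0 := mul_ne_zero hn.ff_ne hn.symm.ff_ne
  rw [eq_inv_smul_iff₀ hne, e]
  generalize sgn ((d && (a ^^ b)) ^^ (a && b)) = s at *
  linear_combination (norm := skip) h1 + (s * gg c z w) • h2
  match_scalars
  all_goals try ring1
  all_goals try linear_combination gg c z w ^ 2 * hss
  all_goals linear_combination (-gg c z w ^ 2) * hss

set_option linter.unusedSimpArgs false in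
set_option maxHeartbeats 8000000 in
lemma Rel.stp {z w u : ℂ} {Dz Dw : Bool → Bool → Module.End ℂ (LL M)} (h : Rel c z w Dz Dw)
    (hn : Nice c z w) (hz : z ≠ u) (hw : w ≠ u) :
    Rel c z w (stp c u z Dz) (stp c u w Dw) := by
  intro a b e d F
  have n1 := hn.sub_ne
  have n2 := hn.symm.sub_ne
  have n3 := hn.2.1
  have n4 := hn.2.2
  have n5 : z - u ≠ 0 := sub_ne_zero.2 hz
  have n6 : w - u ≠ 0 := sub_ne_zero.2 hw
  have sol := h.sol hn
  apply LL_ext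
  · simp
  intro x
  simp only [map_sub, map_smul, hd_stp, Yop_apply, map_add, sol]
  cases a <;> cases b <;> cases e <;> cases d <;> cases x <;>
    simp only [sgn_false, sgn_true, Bool.and_true, Bool.and_false, Bool.true_and, Bool.false_and,
      Bool.xor_true, Bool.xor_false, Bool.true_xor, Bool.false_xor, Bool.not_true, Bool.not_false,
      Bool.true_eq_false, Bool.false_eq_true, if_true, if_false] <;>
    match_scalars <;> first | ring1 | (simp only [ff, gg]; field_simp; try ring1)

lemma Dr_rel (ht : IsTFam c p21 t) : ∀ (us : List ℂ) (z w : ℂ), Nice c z w →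
    (∀ x ∈ us, z ≠ x) → (∀ x ∈ us, w ≠ x) → Rel c z w (Dr c t us z) (Dr c t us w) := by
  intro us
  induction us with
  | nil =>
    intro z w hn _ _ a b e d F
    funext l
    have h1 := rel_app ht (ix a) (ix b) (ix e) (ix d) hn.1 (F l)
    simp only [Dr, Pi.sub_apply, Pi.smul_apply, LinearMap.compLeft_apply, Function.comp]
    have q1 : p21 1 = 0 := rfl
    have q2 : p21 2 = 1 := rfl
    convert h1 using 2 <;> cases a <;> cases b <;> cases e <;> cases d <;> norm_num [q1, q2]
  | cons u us ih =>
    intro z w hn hz hw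
    exact (ih z w hn (fun x hx => hz x (by simp [hx])) (fun x hx => hw x (by simp [hx]))).stp hn
      (hz u (by simp)) (hw u (by simp))

end Nested3


section Nested4

variable {M : Type*} [AddCommGroup M] [Module ℂ M]
variable {c : ℂ} {t : Fin 3 → Fin 3 → ℂ → Module.End ℂ M}

lemma Rsw_nil (u w : ℂ) (P : LL M →ₗ[ℂ] LL M) (F : LL M) : Rsw c u w P F [] = 0 := rfl
lemma Rsw_one (u w : ℂ) (P : LL M →ₗ[ℂ] LL M) (a : Bool) (F : LL M) :
  Rsw c u w P F [a] = 0 := rfl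

set_option maxHeartbeats 2000000 in
/-- exchange operators intertwine the dressed families -/
lemma Rsw_stp {u w v : ℂ} (huw : Nice c u w) (hvu : v ≠ u) (hvw : v ≠ w)
    {D1 D0 : Bool → Bool → Module.End ℂ (LL M)} (P : LL M →ₗ[ℂ] LL M)
    (hP : ∀ b F, P (D1 false b F) = stp c w v D0 false b (P F)) (b : Bool) (F : LL M) :
    Rsw c u w P (stp c u v D1 false b F) =
      stp c w v (stp c u v D0) false b (Rsw c u w P F) := by
  have n1 := huw.sub_ne
  have n2 := huw.symm.sub_ne
  have n3 := huw.2.1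
  have n5 : v - u ≠ 0 := sub_ne_zero.2 hvu
  have n6 : v - w ≠ 0 := sub_ne_zero.2 hvw
  apply LL_ext
  · rfl
  intro a
  apply LL_ext
  · change (0 : M) = hd a (stp c w v (stp c u v D0) false b (Rsw c u w P F)) []
    rw [hd_stp, Yop_apply]
    simp only [Pi.add_apply, Pi.smul_apply, stp_nil, smul_zero, add_zero]
  intro d
  rw [hd_Rsw]
  simp only [hd_stp, map_add, map_smul, hd_Rsw, hP, Yop_apply]
  cases a <;> cases b <;> cases d <;>
    simp only [sgn_false, sgn_true, Bool.and_true, Bool.and_false, Bool.true_and, Bool.false_and,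
      Bool.xor_true, Bool.xor_false, Bool.true_xor, Bool.false_xor, Bool.not_true, Bool.not_false,
      Bool.true_eq_false, Bool.false_eq_true, if_true, if_false] <;>
    match_scalars <;> first | ring1 | (simp only [ff, gg]; field_simp; try ring1)

lemma Pm_Dr : ∀ (us : List ℂ) (j : Fin us.length) (v : ℂ), us.Pairwise (Nice c) →
    (∀ x ∈ us, v ≠ x) → ∀ (b : Bool) (F : LL M),
    Pm c us j (Dr c t us v false b F) =
      Dr c t (us.get j :: us.eraseIdx j) v false b (Pm c us j F) := by
  intro us
  induction us with
  | nil => intro j; exact j.elim0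
  | cons u us ih =>
    intro j v hus hv b F
    rw [List.pairwise_cons] at hus
    refine Fin.cases ?_ (fun j => ?_) j
    · rfl
    · have hP : Pm c (u :: us) (j.succ : ℕ) = Rsw (M := M) c u (us.get j) (Pm c us j) := by
        simp [Pm]
      rw [hP]
      exact Rsw_stp (hus.1 _ (List.get_mem _ _)) (hv u (by simp))
        (hv _ (by simp)) _
        (fun b F => ih j v hus.2 (fun x hx => hv x (by simp [hx])) b F) b F

/-- the dressed vacuum -/
def Om (Ω : M) : List ℂ → LL M
  | [] => fun _ => Ω
  | _ :: us => fun l => match l with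
    | false :: l => Om Ω us l
    | _ => 0

lemma hd_Om_false (Ω : M) (u : ℂ) (us : List ℂ) : hd false (Om Ω (u :: us)) = Om Ω us := rfl
lemma hd_Om_true (Ω : M) (u : ℂ) (us : List ℂ) : hd true (Om Ω (u :: us)) = 0 := rfl
lemma Om_nil (Ω : M) (u : ℂ) (us : List ℂ) : Om Ω (u :: us) [] = 0 := rfl

lemma Pm_Om (Ω : M) : ∀ (us : List ℂ) (j : Fin us.length), us.Pairwise (Nice c) →
    Pm c us j (Om Ω us) = Om Ω (us.get j :: us.eraseIdx j) := by
  intro us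
  induction us with
  | nil => intro j; exact j.elim0
  | cons u us ih =>
    intro j hus
    rw [List.pairwise_cons] at hus
    refine Fin.cases ?_ (fun j => ?_) j
    · rfl
    · have hP : Pm c (u :: us) (j.succ : ℕ) = Rsw (M := M) c u (us.get j) (Pm c us j) := by
        simp [Pm]
      have huw : Nice c u (us.get j) := hus.1 _ (List.get_mem _ _)
      have n1 := huw.sub_ne
      have n3 := huw.2.1
      rw [hP]
      apply LL_ext
      · rfl
      intro a
      apply LL_ext
      · cases a <;> rfl
      intro d
      rw [hd_Rsw]
      change _ = hd d (hd a (Om Ω (us.get j :: u :: us.eraseIdx j)))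
      cases a <;> cases d <;> simp only [hd_Om_false, hd_Om_true, ih j hus.2, map_zero]
      · simp only [Bool.and_self, sgn_false, one_smul]
        match_scalars
        simp only [ff, gg]; field_simp
      all_goals simp

/-- normalized dressed Bethe vector -/
def XX (c : ℂ) (t : Fin 3 → Fin 3 → ℂ → Module.End ℂ M) (Ω : M) (us : List ℂ) : List ℂ → LL M
  | [] => Om Ω us
  | v0 :: v => ((v.map fun y => hh c y v0).prod)⁻¹ • Dr c t us v0 false true (XX c t Ω us v)

lemma Pm_XX (Ω : M) (us : List ℂ) (j : Fin us.length) (hus : us.Pairwise (Nice c)) :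
    ∀ v : List ℂ, (∀ y ∈ v, ∀ x ∈ us, y ≠ x) →
    Pm c us j (XX c t Ω us v) = XX c t Ω (us.get j :: us.eraseIdx j) v := by
  intro v
  induction v with
  | nil => intro _; exact Pm_Om Ω us j hus
  | cons v0 v ih =>
    intro h
    simp only [XX, map_smul]
    rw [Pm_Dr us j v0 hus (h v0 (by simp)), ih (fun y hy => h y (by simp [hy]))]

/-- weights on the vacuum -/
structure HW (t : Fin 3 → Fin 3 → ℂ → Module.End ℂ M) (lam : Fin 3 → ℂ → ℂ) (Ω : M) : Prop where
  low : ∀ i j : Fin 3, j < i → ∀ z : ℂ, t i j z Ω = 0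
  diag : ∀ i : Fin 3, ∀ z : ℂ, t i i z Ω = lam i z • Ω

variable {lam : Fin 3 → ℂ → ℂ} {Ω : M}

lemma Dr_Om_32 (hw : HW t lam Ω) (z : ℂ) : ∀ us : List ℂ,
    Dr c t us z true false (Om Ω us) = 0 := by
  intro us
  induction us with
  | nil => funext l; exact hw.low 2 1 (by decide) z
  | cons u us ih =>
    apply LL_ext
    · rfl
    intro d
    change hd d (stp c u z (Dr c t us z) true false (Om Ω (u :: us))) = 0
    rw [hd_stp, Yop_apply]
    cases d <;> simp [hd_Om_false, hd_Om_true, ih]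

lemma Dr_Om_22 (hw : HW t lam Ω) (z : ℂ) : ∀ us : List ℂ, (∀ x ∈ us, z ≠ x) →
    Dr c t us z false false (Om Ω us) = (lam 1 z * prodFF c [z] us) • Om Ω us := by
  intro us
  induction us with
  | nil => intro _; rw [prodFF_sing_nil, mul_one]; funext l; exact hw.diag 1 z
  | cons u us ih =>
    intro hz
    have n : z - u ≠ 0 := sub_ne_zero.2 (hz u (by simp))
    have ih := ih fun x hx => hz x (by simp [hx])
    apply LL_ext
    · change (0 : M) = (lam 1 z * prodFF c [z] (u :: us)) • (0 : M)
      simp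
    intro d
    change hd d (stp c u z (Dr c t us z) false false (Om Ω (u :: us))) = _
    rw [hd_stp, Yop_apply, prodFF_sing_cons, map_smul]
    cases d <;> simp [hd_Om_false, hd_Om_true, ih]
    match_scalars
    simp only [ff, gg]; field_simp

lemma Dr_Om_33 (hw : HW t lam Ω) (z : ℂ) : ∀ us : List ℂ,
    Dr c t us z true true (Om Ω us) = (lam 2 z) • Om Ω us := by
  intro us
  induction us with
  | nil => funext l; exact hw.diag 2 z
  | cons u us ih =>
    apply LL_ext
    · change (0 : M) = (lam 2 z) • (0 : M)
      simp
    intro d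
    change hd d (stp c u z (Dr c t us z) true true (Om Ω (u :: us))) = _
    rw [hd_stp, Yop_apply, map_smul]
    cases d <;> simp [hd_Om_false, hd_Om_true, ih, Dr_Om_32 hw]

/-- the `gl(1|1)` graded transfer matrix -/
def tr (D : Bool → Bool → Module.End ℂ (LL M)) : Module.End ℂ (LL M) :=
  D false false - D true true

lemma tr_apply (D : Bool → Bool → Module.End ℂ (LL M)) (F : LL M) :
    tr D F = D false false F - D true true F := rfl

lemma Rel.tr_B {z w : ℂ} {Dz Dw : Bool → Bool → Module.End ℂ (LL M)} (h : Rel c z w Dz Dw)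
    (hn : Nice c z w) (F : LL M) :
    tr Dz (Dw false true F) = ff c w z • Dw false true (tr Dz F) +
      gg c z w • Dz false true (tr Dw F) := by
  have n1 := hn.sub_ne
  have n2 := hn.symm.sub_ne
  have n3 := hn.2.1
  have n4 := hn.2.2
  have sol := h.sol hn
  simp only [tr_apply, map_sub, sol]
  simp only [sgn_false, sgn_true, Bool.and_true, Bool.and_false, 
      Bool.xor_true, Bool.xor_false, Bool.not_true, Bool.not_false]
  match_scalars <;> first | ring1 | (simp only [ff, gg]; field_simp; try ring1)

/-- on shell, the transfer matrix at a Bethe root annihilates -/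
lemma tr_XX_zero (ht : IsTFam c p21 t) (us : List ℂ) : ∀ (v : List ℂ),
    v.Pairwise (Nice c) → (∀ y ∈ v, ∀ x ∈ us, y ≠ x) → 
    (∀ y ∈ v, tr (Dr c t us y) (Om Ω us) = 0) → ∀ z, (∀ x ∈ us, z ≠ x) → (∀ y ∈ v, Nice c z y) → 
    tr (Dr c t us z) (Om Ω us) = 0 →
    tr (Dr c t us z) (XX c t Ω us v) = 0 := by
  intro v
  induction v with
  | nil => intro _ _ _ z _ _ h; exact h
  | cons v0 v ih =>
    intro hv hvu hB z hzu hzv h0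
    rw [List.pairwise_cons] at hv
    simp only [XX, map_smul]
    have hR := Dr_rel ht us z v0 (hzv v0 (by simp)) hzu (hvu v0 (by simp))
    rw [hR.tr_B (hzv v0 (by simp)),
      ih hv.2 (fun y hy => hvu y (by simp [hy])) (fun y hy => hB y (by simp [hy])) z hzu
        (fun y hy => hzv y (by simp [hy])) h0,
      ih hv.2 (fun y hy => hvu y (by simp [hy])) (fun y hy => hB y (by simp [hy])) v0
        (hvu v0 (by simp)) (fun y hy => hv.1 y hy) (hB v0 (by simp))]
    simp

lemma tr_XX (ht : IsTFam c p21 t) (us : List ℂ) (z κ : ℂ) (hzu : ∀ x ∈ us, z ≠ x)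
    (h0 : tr (Dr c t us z) (Om Ω us) = κ • Om Ω us) : ∀ (v : List ℂ),
    v.Pairwise (Nice c) → (∀ y ∈ v, ∀ x ∈ us, y ≠ x) →
    (∀ y ∈ v, tr (Dr c t us y) (Om Ω us) = 0) → (∀ y ∈ v, Nice c z y) →
    tr (Dr c t us z) (XX c t Ω us v) = (prodFF c v [z] * κ) • XX c t Ω us v := by
  intro v
  induction v with
  | nil => intro _ _ _ _; simpa [XX] using h0
  | cons v0 v ih =>
    intro hv hvu hB hzv
    rw [List.pairwise_cons] at hv
    have hR := Dr_rel ht us z v0 (hzv v0 (by simp)) hzu (hvu v0 (by simp))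
    simp only [XX, map_smul]
    rw [hR.tr_B (hzv v0 (by simp)),
      ih hv.2 (fun y hy => hvu y (by simp [hy])) (fun y hy => hB y (by simp [hy]))
        (fun y hy => hzv y (by simp [hy])),
      tr_XX_zero ht us v hv.2 (fun y hy => hvu y (by simp [hy])) (fun y hy => hB y (by simp [hy])) v0
        (hvu v0 (by simp)) (fun y hy => hv.1 y hy) (hB v0 (by simp)), prodFF_cons_sing]
    simp only [map_smul, map_zero, smul_zero, add_zero]
    module

/-- commutation with the residue of the transfer matrix -/
lemma Rel.K_B {u w : ℂ} {Du Dw : Bool → Bool → Module.End ℂ (LL M)} (h : Rel c u w Du Dw)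
    (hn : Nice c u w) (a : Bool) (F : LL M) :
    sgn a • Yop Du a (Bethe.stp c u w Dw false true F) =
      ff c w u • (sgn a • Dw false true (sgn a • Yop Du a F) +
        (if a = true then gg c w u else 0) • (Dw false false (Yop Du false F)
          - Dw false true (Yop Du true F))) +
      (if a = true then gg c u w else 0) • Yop Du false (tr (Bethe.stp c u w Dw) F) := by
  have n1 := hn.sub_ne
  have n2 := hn.symm.sub_ne
  have n3 := hn.2.1
  have n4 := hn.2.2
  have sol := h.sol hn
  simp only [tr_apply, map_sub, Yop_apply, hd_stp, map_add, map_smul, sol]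
  cases a <;>
  simp only [sgn_false, sgn_true, Bool.and_true, Bool.and_false, Bool.true_and, Bool.false_and,
      Bool.xor_true, Bool.xor_false, Bool.not_true, Bool.not_false,
      Bool.true_eq_false, Bool.false_eq_true, if_true, if_false] <;>
  match_scalars <;> first | ring1 | (simp only [ff, gg]; field_simp; try ring1)

end Nested4


section Nested5

variable {M : Type*} [AddCommGroup M] [Module ℂ M]
variable {c : ℂ} {t : Fin 3 → Fin 3 → ℂ → Module.End ℂ M}
variable {lam : Fin 3 → ℂ → ℂ} {Ω : M}

/-- residue of the transfer matrix on the dressed Bethe vector -/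
lemma K_XX (ht : IsTFam c p21 t) (hw : HW t lam Ω) (u0 : ℂ) (us : List ℂ)
    (hu : ∀ x ∈ us, u0 ≠ x) : ∀ v : List ℂ, v.Pairwise (Nice c) →
    (∀ y ∈ v, ∀ x ∈ us, y ≠ x) → (∀ y ∈ v, Nice c u0 y) →
    (∀ y ∈ v, tr (Dr c t (u0 :: us) y) (Om Ω (u0 :: us)) = 0) → ∀ a : Bool,
    sgn a • Yop (Dr c t us u0) a (XX c t Ω (u0 :: us) v) =
      (lam 1 u0 * prodFF c [u0] us * prodFF c v [u0]) • hd a (XX c t Ω (u0 :: us) v) := by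
  intro v
  induction v with
  | nil =>
    intro _ _ _ _ a
    simp only [XX]
    rw [Yop_apply, hd_Om_true, hd_Om_false, prodFF_nil_sing, mul_one]
    cases a
    · rw [Dr_Om_22 hw u0 us hu, hd_Om_false]; simp
    · rw [Dr_Om_32 hw, hd_Om_true]; simp
  | cons v0 v ih =>
    intro hv hvu huv hB a
    rw [List.pairwise_cons] at hv
    have ih := ih hv.2 (fun y hy => hvu y (by simp [hy])) (fun y hy => huv y (by simp [hy]))
      (fun y hy => hB y (by simp [hy]))
    have hz : tr (Dr c t (u0 :: us) v0) (XX c t Ω (u0 :: us) v) = 0 := by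
      refine tr_XX_zero ht (u0 :: us) v hv.2 ?_ (fun y hy => hB y (by simp [hy])) v0 ?_
        hv.1 (hB v0 (by simp))
      · intro y hy x hx
        rcases List.mem_cons.1 hx with rfl | hx
        · exact (huv y (by simp [hy])).1.symm
        · exact hvu y (by simp [hy]) x hx
      · intro x hx
        rcases List.mem_cons.1 hx with rfl | hx
        · exact (huv v0 (by simp)).1.symm
        · exact hvu v0 (by simp) x hx
    have hR := Dr_rel ht us u0 v0 (huv v0 (by simp)) hu (hvu v0 (by simp))
    have hK := hR.K_B (huv v0 (by simp)) a (XX c t Ω (u0 :: us) v)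
    change tr (stp c u0 v0 (Dr c t us v0)) _ = 0 at hz
    rw [hz] at hK
    have hf := ih false
    have hT := ih true
    simp only [sgn_false, one_smul, sgn_true, neg_smul, neg_eq_iff_eq_neg] at hf hT
    change sgn a • Yop (Dr c t us u0) a
        (((v.map fun y => hh c y v0).prod)⁻¹ • stp c u0 v0 (Dr c t us v0) false true _) =
      _ • hd a (((v.map fun y => hh c y v0).prod)⁻¹ • stp c u0 v0 (Dr c t us v0) false true _)
    rw [ih a, hf, hT] at hK
    rw [map_smul, smul_comm, hK, map_smul (hd a), hd_stp, prodFF_cons_sing, map_zero, Yop_apply]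
    cases a <;> simp only [sgn_false, sgn_true, Bool.and_true, Bool.and_false, Bool.true_and,
      Bool.false_and, Bool.xor_true, Bool.xor_false, Bool.not_true, Bool.not_false, map_neg,
      Bool.true_eq_false, Bool.false_eq_true, if_true, if_false, map_smul, map_zero] <;> module

/-- vectors annihilated by `T₂₁`, `T₃₁` and of fixed `T₁₁`-weight -/
def Good (t : Fin 3 → Fin 3 → ℂ → Module.End ℂ M) (lam : Fin 3 → ℂ → ℂ) (Z : ℂ → Prop)
    (F : LL M) : Prop :=
  ∀ p, Z p → ∀ l, t 0 0 p (F l) = lam 0 p • F l ∧ ∀ a, t (ix a) 0 p (F l) = 0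

lemma Good.add {Z : ℂ → Prop} {F G : LL M} (hF : Good t lam Z F) (hG : Good t lam Z G) :
    Good t lam Z (F + G) := by
  intro p hp l
  refine ⟨?_, fun a => ?_⟩
  · simp [(hF p hp l).1, (hG p hp l).1]
  · simp [(hF p hp l).2 a, (hG p hp l).2 a]

lemma Good.smul {Z : ℂ → Prop} {F : LL M} (hF : Good t lam Z F) (r : ℂ) :
    Good t lam Z (r • F) := by
  intro p hp l
  refine ⟨?_, fun a => ?_⟩
  · simp [(hF p hp l).1, smul_comm r]
  · simp [(hF p hp l).2 a]

lemma Good.hd {Z : ℂ → Prop} {F : LL M} (hF : Good t lam Z F) (d : Bool) :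
    Good t lam Z (hd d F) := fun p hp l => hF p hp (d :: l)

lemma Good.Dr (ht : IsTFam c p21 t) {Z : ℂ → Prop} {q : ℂ} (hq : Z q) :
    ∀ (us : List ℂ) (a b : Bool) {F : LL M}, Good t lam Z F →
    Good t lam (fun p => p ≠ q ∧ Z p) (Dr c t us q a b F) := by
  intro us
  induction us with
  | nil =>
    intro a b F hF p hp l
    change t 0 0 p (t (ix a) (ix b) q (F l)) = lam 0 p • t (ix a) (ix b) q (F l) ∧
      ∀ e, t (ix e) 0 p (t (ix a) (ix b) q (F l)) = 0
    refine ⟨?_, fun e => ?_⟩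
    · have h1 := rel_app ht 0 0 (ix a) (ix b) hp.1 (F l)
      rw [(hF p hp.2 l).2, (hF q hq l).2, (hF p hp.2 l).1] at h1
      simpa [p21, sub_eq_zero] using h1
    · have h1 := rel_app ht (ix e) 0 (ix a) (ix b) hp.1 (F l)
      rw [(hF p hp.2 l).2, (hF q hq l).2, (hF p hp.2 l).2] at h1
      simpa using h1
  | cons u us ih =>
    intro a b F hF p hp l
    cases l with
    | nil =>
      change t 0 0 p (0 : M) = lam 0 p • (0 : M) ∧ ∀ e, t (ix e) 0 p (0 : M) = 0
      simp
    | cons d l =>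
      exact (((ih a b (hF.hd d)).smul _).add
        (((ih a false (hF.hd false)).add ((ih a true (hF.hd true)).smul (sgn a))).smul _)) p hp l

lemma Good.Om (hw : HW t lam Ω) (us : List ℂ) : Good t lam (fun _ => True) (Om Ω us) := by
  induction us with
  | nil =>
    intro p _ l
    exact ⟨hw.diag 0 p, fun a => by cases a; exacts [hw.low 1 0 (by decide) p, hw.low 2 0 (by decide) p]⟩
  | cons u us ih =>
    intro p hp l
    have h0 : t 0 0 p (0 : M) = lam 0 p • (0 : M) ∧ ∀ e, t (ix e) 0 p (0 : M) = 0 := by simp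
    rcases l with _ | ⟨_ | _, l⟩
    · exact h0
    · exact ih p hp l
    · exact h0

lemma Good.XX (ht : IsTFam c p21 t) (hw : HW t lam Ω) (us : List ℂ) : ∀ v : List ℂ, v.Pairwise (Nice c) →
    Good t lam (fun p => ∀ y ∈ v, p ≠ y) (XX c t Ω us v) := by
  intro v
  induction v with
  | nil => intro _ p _ l; exact Good.Om hw us p trivial l
  | cons v0 v ih =>
    intro hv
    rw [List.pairwise_cons] at hv
    have := ((ih hv.2).Dr ht (q := v0) (fun y hy => (hv.1 y hy).1) us false true).smul
      (((v.map fun y => hh c y v0).prod)⁻¹)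
    intro p hp
    exact this p ⟨hp v0 (by simp), fun y hy => hp y (by simp [hy])⟩

lemma T11p_XX (ht : IsTFam c p21 t) (hw : HW t lam Ω) (us v : List ℂ) (hv : v.Pairwise (Nice c)) (p : ℂ)
    (hp : ∀ y ∈ v, p ≠ y) : T11p t p (XX c t Ω us v) = lam 0 p • XX c t Ω us v := by
  funext l
  exact (Good.XX ht hw us v hv p hp l).1

lemma prodFF_perm (y : ℂ) {l l' : List ℂ} (h : l.Perm l') : prodFF c [y] l = prodFF c [y] l' := by
  unfold prodFF
  simp only [List.map_cons, List.map_nil, List.prod_cons, List.prod_nil, mul_one]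
  exact (h.map _).prod_eq

lemma tr_Om (hw : HW t lam Ω) (us : List ℂ) (z : ℂ) (hz : ∀ x ∈ us, z ≠ x) :
    tr (Dr c t us z) (Om Ω us) = (lam 1 z * prodFF c [z] us - lam 2 z) • Om Ω us := by
  rw [tr_apply, Dr_Om_22 hw z us hz, Dr_Om_33 hw z us, sub_smul]

/-- the eigenvalue equation for the nested Bethe vector -/
theorem eigen (ht : IsTFam c p21 t) (hw : HW t lam Ω) (u v : List ℂ) (z : ℂ)
    (hu : u.Pairwise (Nice c)) (hv : v.Pairwise (Nice c)) (huv : ∀ x ∈ u, ∀ y ∈ v, Nice c x y)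
    (hzu : ∀ x ∈ u, Nice c z x) (hzv : ∀ y ∈ v, Nice c z y)
    (hbetheU : ∀ j : Fin u.length,
        lam 0 (u.get j) * prodFF c (u.eraseIdx (j : ℕ)) [u.get j]
          = lam 1 (u.get j) * prodFF c [u.get j] (u.eraseIdx (j : ℕ)) *
              prodFF c v [u.get j])
    (hbetheV : ∀ y ∈ v, lam 2 y = lam 1 y * prodFF c [y] u) :
    t 0 0 z (BB t u (XX c t Ω u v)) + t 1 1 z (BB t u (XX c t Ω u v))
      - t 2 2 z (BB t u (XX c t Ω u v)) =
    (lam 0 z * prodFF c u [z] + lam 1 z * prodFF c [z] u * prodFF c v [z]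
      - lam 2 z * prodFF c v [z]) • BB t u (XX c t Ω u v) := by
  have hzu' : ∀ x ∈ u, z ≠ x := fun x hx => (hzu x hx).1
  have hvu' : ∀ y ∈ v, ∀ x ∈ u, y ≠ x := fun y hy x hx => (huv x hx y hy).1.symm
  have hA := L1a ht u z hzu' hu (XX c t Ω u v)
  have hF := L1b ht u z hzu' hu false false (XX c t Ω u v)
  have hG := L1b ht u z hzu' hu true true (XX c t Ω u v)
  have hB : ∀ y ∈ v, tr (Dr c t u y) (Om Ω u) = 0 := by
    intro y hy
    rw [tr_Om hw u y (hvu' y hy), hbetheV y hy, sub_self, zero_smul]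
  have hT := congrArg (BB t u) (tr_XX ht u z _ hzu' (tr_Om hw u z hzu') v hv hvu' hB hzv)
  rw [tr_apply, map_sub, map_smul] at hT
  rw [T11p_XX ht hw u v hv z (fun y hy => (hzv y hy).1), map_smul] at hA
  have key : ∀ j : Fin u.length, unwA c t u z (XX c t Ω u v) j
      - unwB c t u z false false (XX c t Ω u v) j + unwB c t u z true true (XX c t Ω u v) j = 0 := by
    intro j
    have hperm : (u.get j :: u.eraseIdx j).Perm u := by
      simpa using List.getElem_cons_eraseIdx_perm j.2
    have hpw : (u.get j :: u.eraseIdx j).Pairwise (Nice c) :=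
      (hperm.pairwise_iff (fun {a b} h => Nice.symm h)).2 hu
    rw [List.pairwise_cons] at hpw
    have hmem : ∀ x ∈ u.get j :: u.eraseIdx j, x ∈ u := fun x hx => hperm.subset hx
    have huj : u.get j ∈ u := List.get_mem _ _
    have hK := K_XX (t := t) (lam := lam) (Ω := Ω) ht hw (u.get j) (u.eraseIdx j)
      (fun x hx => (hpw.1 x hx).1) v hv
      (fun y hy x hx => hvu' y hy x (hmem x (by simp [hx]))) (fun y hy => huv _ huj y hy)
      (by
        intro y hy
        rw [tr_Om hw _ y (fun x hx => hvu' y hy x (hmem x hx)), prodFF_perm y hperm, hbetheV y hy,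
          sub_self, zero_smul])
    have hf := hK false
    have hT := hK true
    simp only [sgn_false, one_smul, sgn_true, neg_smul, neg_eq_iff_eq_neg] at hf hT
    unfold unwA unwB
    rw [Pm_XX Ω u j hu v hvu', ← hd_T11p, ← hd_T11p,
      T11p_XX ht hw _ v hv _ (fun y hy => (huv _ huj y hy).1), hf, hT]
    simp only [map_smul, map_neg, ix_false, ix_true]
    rw [← hbetheU j]
    module
  have key' := Finset.sum_eq_zero fun j (_ : j ∈ Finset.univ) => key j
  rw [Finset.sum_add_distrib, Finset.sum_sub_distrib] at key'
  rw [ix_false] at hF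
  rw [ix_true] at hG
  linear_combination (norm := module) hA + hF - hG + hT + key'

end Nested5


section Abstract

variable {N : Type*} [AddCommGroup N] [Module ℂ N] {c : ℂ}

lemma Nice.hh_ne (hc : c ≠ 0) {x y : ℂ} (h : Nice c x y) : hh c x y ≠ 0 :=
  div_ne_zero h.2.1 hc

/-- an abstract pair of operator families with the exchange relations of `T₁₂`, `T₁₃` -/
structure ABrel (c : ℂ) (Z : Finset ℂ) (A B : ℂ → Module.End ℂ N) : Prop where
  c0 : c ≠ 0
  nice : ∀ z ∈ Z, ∀ w ∈ Z, z ≠ w → Nice c z w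
  ab : ∀ z ∈ Z, ∀ w ∈ Z, z ≠ w → ∀ x,
    A z (B w x) = ff c w z • B w (A z x) + gg c z w • B z (A w x)
  bb : ∀ z ∈ Z, ∀ w ∈ Z, z ≠ w → ∀ x, hh c w z • B w (B z x) = hh c z w • B z (B w x)

variable {Z : Finset ℂ} {A B : ℂ → Module.End ℂ N}

lemma TT_cons (x : ℂ) (l : List ℂ) (y : N) :
    TT c B (x :: l) y = ((l.map fun y => hh c y x).prod)⁻¹ • B x (TT c B l y) := by
  simp only [TT, Hnorm, Tprod, List.map_cons, List.prod_cons, LinearMap.smul_apply,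
    Module.End.mul_apply, map_smul, mul_inv, mul_smul]

lemma TT_nil (y : N) : TT c B [] y = y := by simp [TT, Hnorm, Tprod]

lemma ABrel.perm (h : ABrel c Z A B) {l l' : List ℂ} (hp : l.Perm l') :
    l.Nodup → (∀ x ∈ l, x ∈ Z) → ∀ y, TT c B l y = TT c B l' y := by
  induction hp with
  | nil => intros; rfl
  | cons x hp ih =>
    intro hn hZ y
    rw [TT_cons, TT_cons, ih (List.nodup_cons.1 hn).2 (fun x hx => hZ x (by simp [hx])),
      (hp.map _).prod_eq]
  | swap x y l =>
    intro hn hZ v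
    have hx : x ∈ Z := hZ x (by simp)
    have hy : y ∈ Z := hZ y (by simp)
    have hxy : x ≠ y := by
      rintro rfl
      simp at hn
    have h1 := h.bb x hx y hy hxy (TT c B l v)
    have n1 := (h.nice x hx y hy hxy).hh_ne h.c0
    have n2 := (h.nice x hx y hy hxy).symm.hh_ne h.c0
    simp only [TT_cons, List.map_cons, List.prod_cons, map_smul]
    have h2 : B y (B x (TT c B l v)) = ((hh c y x)⁻¹ * hh c x y) • B x (B y (TT c B l v)) := by
      rw [mul_smul, ← h1, smul_smul, inv_mul_cancel₀ n2, one_smul]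
    rw [h2]
    simp only [smul_smul]
    congr 1
    field_simp
  | trans h1 _ ih1 ih2 =>
    intro hn hZ y
    rw [ih1 hn hZ, ih2 (h1.nodup_iff.1 hn) (fun x hx => hZ x (h1.mem_iff.2 hx))]

/-- symmetric normalized product over a finite set -/
def Cs (c : ℂ) (B : ℂ → Module.End ℂ N) (V : Finset ℂ) : Module.End ℂ N := TT c B V.toList

lemma ABrel.list (h : ABrel c Z A B) {l : List ℂ} (hn : l.Nodup) (hZ : ∀ x ∈ l, x ∈ Z) (y : N) :
    TT c B l y = Cs c B l.toFinset y :=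
  h.perm (List.toFinset_toList hn).symm hn hZ y

lemma ABrel.ins (h : ABrel c Z A B) {w : ℂ} {V : Finset ℂ} (hw : w ∉ V) (hwZ : w ∈ Z) (hV : V ⊆ Z)
    (y : N) : B w (Cs c B V y) = (∏ x ∈ V, hh c x w) • Cs c B (insert w V) y := by
  have h1 := h.perm (Finset.toList_insert hw).symm (by simp [hw, Finset.nodup_toList])
    (by
      intro x hx
      rcases List.mem_cons.1 hx with rfl | hx
      · exact hwZ
      · exact hV (Finset.mem_toList.1 hx)) y
  have e : (V.toList.map fun y => hh c y w).prod = ∏ x ∈ V, hh c x w := Finset.prod_map_toList _ _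
  have ne : ∏ x ∈ V, hh c x w ≠ 0 := Finset.prod_ne_zero_iff.2 fun x hx =>
    (h.nice x (hV hx) w hwZ (fun e => hw (e ▸ hx))).hh_ne h.c0
  rw [Cs, Cs, ← h1, TT_cons, e, smul_smul, mul_inv_cancel₀ ne, one_smul]

lemma Cs_empty (y : N) : Cs c B ∅ y = y := by simp [Cs, TT_nil]

lemma gh (hc : c ≠ 0) {x y : ℂ} (h : x ≠ y) : ff c x y = gg c x y * hh c x y := by
  have := sub_ne_zero.2 h
  unfold ff gg hh
  field_simp

/-- moving `A` through the symmetric product -/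
lemma ABrel.AC (h : ABrel c Z A B) : ∀ (V : Finset ℂ), V ⊆ Z → ∀ z ∈ Z, z ∉ V → ∀ y : N,
    A z (Cs c B V y) = (∏ x ∈ V, ff c x z) • Cs c B V (A z y) +
      ∑ k ∈ V, (gg c z k * ∏ x ∈ V.erase k, gg c x k) • B z (Cs c B (V.erase k) (A k y)) := by
  intro V
  induction V using Finset.induction_on with
  | empty => intros; simp [Cs_empty]
  | insert w V hw ih =>
    intro hV z hz hzV y
    have hwZ : w ∈ Z := hV (by simp)
    have hVZ : V ⊆ Z := fun x hx => hV (by simp [hx])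
    have hzV' : z ∉ V := fun hx => hzV (by simp [hx])
    have hzw : z ≠ w := fun e => hzV (by simp [e])
    have nzw := h.nice z hz w hwZ hzw
    have ne : ∏ x ∈ V, hh c x w ≠ 0 := Finset.prod_ne_zero_iff.2 fun x hx =>
      (h.nice x (hVZ hx) w hwZ (fun e => hw (e ▸ hx))).hh_ne h.c0
    have e1 : ∀ y, Cs c B (insert w V) y = (∏ x ∈ V, hh c x w)⁻¹ • B w (Cs c B V y) := by
      intro y
      rw [h.ins hw hwZ hVZ, smul_smul, inv_mul_cancel₀ ne, one_smul]
    rw [e1, map_smul, h.ab z hz w hwZ hzw, ih hVZ z hz hzV', ih hVZ w hwZ hw,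
      Finset.prod_insert hw, Finset.sum_insert hw, Finset.erase_insert hw, e1]
    have e2 : (∏ x ∈ V, ff c x w) = (∏ x ∈ V, gg c x w) * ∏ x ∈ V, hh c x w := by
      rw [← Finset.prod_mul_distrib]
      exact Finset.prod_congr rfl fun x hx => gh h.c0 (fun e => hw (e ▸ hx))
    have e3 : ∀ k ∈ V, (gg c z k * ∏ x ∈ (insert w V).erase k, gg c x k) •
        B z (Cs c B ((insert w V).erase k) (A k y)) =
        (∏ x ∈ V, hh c x w)⁻¹ • (
          ff c w z • B w ((gg c z k * ∏ x ∈ V.erase k, gg c x k) •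
            B z (Cs c B (V.erase k) (A k y))) +
          gg c z w • B z ((gg c w k * ∏ x ∈ V.erase k, gg c x k) •
            B w (Cs c B (V.erase k) (A k y)))) := by
      intro k hk
      have hkw : k ≠ w := fun e => hw (e ▸ hk)
      have hkz : k ≠ z := fun e => hzV' (e ▸ hk)
      have hwk : w ∉ V.erase k := fun hx => hw (Finset.mem_of_mem_erase hx)
      have hVk : V.erase k ⊆ Z := fun x hx => hVZ (Finset.mem_of_mem_erase hx)
      rw [Finset.erase_insert_of_ne hkw.symm, Finset.prod_insert hwk]
      have ne' : ∏ x ∈ V.erase k, hh c x w ≠ 0 := Finset.prod_ne_zero_iff.2 fun x hx =>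
        (h.nice x (hVk hx) w hwZ (fun e => hwk (e ▸ hx))).hh_ne h.c0
      have e4 : ∏ x ∈ V, hh c x w = hh c k w * ∏ x ∈ V.erase k, hh c x w :=
        (Finset.mul_prod_erase V _ hk).symm
      have nk := (h.nice k (hVZ hk) w hwZ hkw).hh_ne h.c0
      have e5 : Cs c B (insert w (V.erase k)) (A k y) =
          (∏ x ∈ V.erase k, hh c x w)⁻¹ • B w (Cs c B (V.erase k) (A k y)) := by
        rw [h.ins hwk hwZ hVk, smul_smul, inv_mul_cancel₀ ne', one_smul]
      have hb := h.bb z hz w hwZ hzw (Cs c B (V.erase k) (A k y))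
      have n1 := nzw.hh_ne h.c0
      have n2 := nzw.symm.hh_ne h.c0
      have h2 : B w (B z (Cs c B (V.erase k) (A k y))) =
          ((hh c w z)⁻¹ * hh c z w) • B z (B w (Cs c B (V.erase k) (A k y))) := by
        rw [mul_smul, ← hb, smul_smul, inv_mul_cancel₀ n2, one_smul]
      simp only [map_smul, e5, h2, e4, mul_inv]
      generalize (∏ x ∈ V.erase k, hh c x w)⁻¹ = p
      generalize (∏ x ∈ V.erase k, gg c x k) = q
      have i1 := sub_ne_zero.2 hzw
      have i2 := sub_ne_zero.2 hzw.symm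
      have i3 := sub_ne_zero.2 hkw
      have i4 := sub_ne_zero.2 hkw.symm
      have i5 := sub_ne_zero.2 hkz
      have i6 := sub_ne_zero.2 hkz.symm
      have i7 := nzw.2.1
      have i8 := nzw.2.2
      have i9 := (h.nice k (hVZ hk) w hwZ hkw).2.1
      have i0 := h.c0
      match_scalars
      simp only [ff, gg, hh]
      field_simp
      ring1
    rw [Finset.sum_congr rfl e3, ← Finset.smul_sum, Finset.sum_add_distrib, e2]
    simp only [map_add, map_smul, map_sum, ← Finset.smul_sum]
    match_scalars <;> field_simp

/-- partial fractions -/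
lemma pf0 (hc : c ≠ 0) (Q S : Finset ℂ) (h : S.card < Q.card) (x : ℂ) (hx : x ∉ Q) :
    (∏ q ∈ Q, gg c q x) * ∏ s ∈ S, hh c x s =
      ∑ k ∈ Q, (∏ s ∈ S, hh c k s) * gg c k x * ∏ q ∈ Q.erase k, gg c q k := by
  classical
  let P : Polynomial ℂ := ∏ s ∈ S, (Polynomial.C c⁻¹ * (Polynomial.X - Polynomial.C (s - c)))
  have hP : ∀ y, P.eval y = ∏ s ∈ S, hh c y s := by
    intro y
    simp only [P, Polynomial.eval_prod, Polynomial.eval_mul, Polynomial.eval_C, Polynomial.eval_sub,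
      Polynomial.eval_X]
    refine Finset.prod_congr rfl fun s _ => ?_
    unfold hh
    field_simp
    ring
  have hd : P.degree < Q.card := by
    refine lt_of_le_of_lt (Polynomial.degree_prod_le _ _) ?_
    refine lt_of_le_of_lt (Finset.sum_le_sum (g := fun _ => (1 : WithBot ℕ)) fun s _ => ?_) ?_
    · refine (Polynomial.degree_mul_le _ _).trans ?_
      rw [Polynomial.degree_C (inv_ne_zero hc), Polynomial.degree_X_sub_C, zero_add]
    · simp only [Finset.sum_const, nsmul_eq_mul, mul_one]
      exact_mod_cast h
  have h1 := Lagrange.eq_interpolate (s := Q) (v := id) (Function.injective_id.injOn) hd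
  have h2 := congrArg (Polynomial.eval x) h1
  rw [Lagrange.eval_interpolate_not_at_node _ (fun i hi => fun e => hx (by simpa [e] using hi)),
    hP, Lagrange.eval_nodal] at h2
  simp only [id, hP, Lagrange.nodalWeight] at h2
  rw [h2, Finset.mul_sum, Finset.mul_sum]
  refine Finset.sum_congr rfl fun k hk => ?_
  have hxk : x - k ≠ 0 := sub_ne_zero.2 fun e => hx (e ▸ hk)
  have hkx : k - x ≠ 0 := sub_ne_zero.2 fun e => hx (e ▸ hk)
  rw [← Finset.mul_prod_erase Q (fun q => gg c q x) hk, ← Finset.mul_prod_erase Q (fun q => x - q) hk]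
  have e : (∏ q ∈ Q.erase k, gg c q k) = (∏ q ∈ Q.erase k, gg c q x) *
      ((∏ q ∈ Q.erase k, (x - q)) * ∏ q ∈ Q.erase k, (k - q)⁻¹) := by
    rw [← Finset.prod_mul_distrib, ← Finset.prod_mul_distrib]
    refine Finset.prod_congr rfl fun q hq => ?_
    have hq' := Finset.mem_erase.1 hq
    have a1 : x - q ≠ 0 := sub_ne_zero.2 fun e => hx (e ▸ hq'.2)
    have a2 : q - x ≠ 0 := sub_ne_zero.2 fun e => hx (e ▸ hq'.2)
    have a3 : k - q ≠ 0 := sub_ne_zero.2 fun e => hq'.1 e.symm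
    have a4 : q - k ≠ 0 := sub_ne_zero.2 fun e => hq'.1 e
    unfold gg
    field_simp
    ring
  rw [e]
  generalize (∏ q ∈ Q.erase k, gg c q x) = p1
  generalize (∏ q ∈ Q.erase k, (x - q)) = p2
  generalize (∏ q ∈ Q.erase k, (k - q)⁻¹) = p3
  field_simp

lemma pf1 (hc : c ≠ 0) (Q S : Finset ℂ) (h : S.card < Q.card) : ∀ (R : Finset ℂ),
    (∀ r ∈ R, r ∉ Q) → ∀ x, x ∉ Q → x ∉ R →
    (∏ q ∈ Q, gg c q x) * (∏ r ∈ R, ff c x r) * ∏ s ∈ S, hh c x s =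
      (∑ k ∈ Q, (∏ r ∈ R, ff c k r) * (∏ s ∈ S, hh c k s) * gg c k x * ∏ q ∈ Q.erase k, gg c q k) +
      ∑ j ∈ R, gg c x j * (∏ q ∈ Q, gg c q j) * (∏ r ∈ R.erase j, ff c j r) * ∏ s ∈ S, hh c j s := by
  intro R
  induction R using Finset.induction_on with
  | empty => intro _ x hx _; simpa using pf0 hc Q S h x hx
  | insert r0 R hr ih =>
    intro hR x hx hxR
    have hR' : ∀ r ∈ R, r ∉ Q := fun r hr => hR r (by simp [hr])
    have hxr : x ≠ r0 := fun e => hxR (by simp [e])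
    have hxR' : x ∉ R := fun hx => hxR (by simp [hx])
    have hrQ : r0 ∉ Q := hR r0 (by simp)
    have h1 := ih hR' x hx hxR'
    have h2 := ih hR' r0 hrQ hr
    have i1 := sub_ne_zero.2 hxr
    have i2 := sub_ne_zero.2 hxr.symm
    have s1 : (∑ k ∈ Q, (∏ r ∈ insert r0 R, ff c k r) * (∏ s ∈ S, hh c k s) * gg c k x *
          ∏ q ∈ Q.erase k, gg c q k) =
        ff c x r0 * (∑ k ∈ Q, (∏ r ∈ R, ff c k r) * (∏ s ∈ S, hh c k s) * gg c k x *
          ∏ q ∈ Q.erase k, gg c q k) - gg c x r0 * 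
        (∑ k ∈ Q, (∏ r ∈ R, ff c k r) * (∏ s ∈ S, hh c k s) * gg c k r0 *
          ∏ q ∈ Q.erase k, gg c q k) := by
      rw [Finset.mul_sum, Finset.mul_sum, ← Finset.sum_sub_distrib]
      refine Finset.sum_congr rfl fun k hk => ?_
      rw [Finset.prod_insert hr]
      have a1 : k - x ≠ 0 := sub_ne_zero.2 fun e => hx (e ▸ hk)
      have a2 : k - r0 ≠ 0 := sub_ne_zero.2 fun e => hrQ (e ▸ hk)
      have e : ff c k r0 * gg c k x = ff c x r0 * gg c k x - gg c x r0 * gg c k r0 := by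
        unfold ff gg; field_simp; ring
      linear_combination ((∏ r ∈ R, ff c k r) * (∏ s ∈ S, hh c k s) * ∏ q ∈ Q.erase k, gg c q k) * e
    have s2 : (∑ j ∈ R, gg c x j * (∏ q ∈ Q, gg c q j) * (∏ r ∈ (insert r0 R).erase j, ff c j r) *
          ∏ s ∈ S, hh c j s) =
        ff c x r0 * (∑ j ∈ R, gg c x j * (∏ q ∈ Q, gg c q j) * (∏ r ∈ R.erase j, ff c j r) *
          ∏ s ∈ S, hh c j s) - gg c x r0 *
        (∑ j ∈ R, gg c r0 j * (∏ q ∈ Q, gg c q j) * (∏ r ∈ R.erase j, ff c j r) *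
          ∏ s ∈ S, hh c j s) := by
      rw [Finset.mul_sum, Finset.mul_sum, ← Finset.sum_sub_distrib]
      refine Finset.sum_congr rfl fun j hj => ?_
      have hj0 : r0 ≠ j := fun e => hr (e ▸ hj)
      rw [Finset.erase_insert_of_ne hj0, Finset.prod_insert (fun hx => hr (Finset.mem_of_mem_erase hx))]
      have a1 : x - j ≠ 0 := sub_ne_zero.2 fun e => hxR' (e ▸ hj)
      have a2 : j - r0 ≠ 0 := sub_ne_zero.2 hj0.symm
      have a3 : r0 - j ≠ 0 := sub_ne_zero.2 hj0
      have e : ff c j r0 * gg c x j = ff c x r0 * gg c x j - gg c x r0 * gg c r0 j := by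
        unfold ff gg; field_simp; ring
      linear_combination ((∏ q ∈ Q, gg c q j) * (∏ r ∈ R.erase j, ff c j r) * ∏ s ∈ S, hh c j s) * e
    rw [Finset.sum_insert hr, s1, s2, Finset.erase_insert hr, Finset.prod_insert hr]
    linear_combination ff c x r0 * h1 - gg c x r0 * h2

end Abstract


section Nested7

variable {M : Type*} [AddCommGroup M] [Module ℂ M]
variable {c : ℂ} {t : Fin 3 → Fin 3 → ℂ → Module.End ℂ M}
variable {lam : Fin 3 → ℂ → ℂ} {Ω : M} {Z : Finset ℂ}

lemma Dr_AB (hc : c ≠ 0) (ht : IsTFam c p21 t) (us : List ℂ)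
    (hZ : ∀ z ∈ Z, ∀ w ∈ Z, z ≠ w → Nice c z w) (hZu : ∀ z ∈ Z, ∀ x ∈ us, z ≠ x) :
    ABrel c Z (fun z => Dr c t us z false false) (fun z => Dr c t us z false true) where
  c0 := hc
  nice := hZ
  ab := by
    intro z hz w hw hzw F
    have hn := hZ z hz w hw hzw
    have n1 := hn.sub_ne
    have n2 := hn.symm.sub_ne
    have n3 := hn.2.1
    have n4 := hn.2.2
    have sol := (Dr_rel ht us z w hn (hZu z hz) (hZu w hw)).sol hn
    simp only [sol]
    simp only [sgn_false, sgn_true, Bool.and_true, Bool.and_false, Bool.and_self, Bool.xor_self,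
      Bool.xor_true, Bool.xor_false, Bool.not_true, Bool.not_false]
    match_scalars <;> first | ring1 | (simp only [ff, gg]; field_simp; try ring1)
  bb := by
    intro z hz w hw hzw F
    have hn := hZ z hz w hw hzw
    have n1 := hn.sub_ne
    have n2 := hn.symm.sub_ne
    have n3 := hn.2.1
    have n4 := hn.2.2
    have sol := (Dr_rel ht us z w hn (hZu z hz) (hZu w hw)).sol hn
    simp only [sol]
    simp only [sgn_false, sgn_true, Bool.and_true, Bool.and_false, Bool.and_self, Bool.xor_self,
      Bool.xor_true, Bool.xor_false, Bool.not_true, Bool.not_false]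
    match_scalars <;> first | ring1 | (simp only [ff, gg, hh]; field_simp; try ring1)

lemma XX_TT (us v : List ℂ) :
    XX c t Ω us v = TT c (fun z => Dr c t us z false true) v (Om Ω us) := by
  induction v with
  | nil => rw [TT_nil]; rfl
  | cons v0 v ih => rw [TT_cons, ← ih]; rfl

/-- symmetric dressed Bethe vector -/
def Xs (c : ℂ) (t : Fin 3 → Fin 3 → ℂ → Module.End ℂ M) (Ω : M) (us : List ℂ) (V : Finset ℂ) :
    LL M := Cs c (fun z => Dr c t us z false true) V (Om Ω us)

lemma Xs_A (hc : c ≠ 0) (ht : IsTFam c p21 t) (hw : HW t lam Ω) (us : List ℂ)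
    (hZ : ∀ z ∈ Z, ∀ w ∈ Z, z ≠ w → Nice c z w) (hZu : ∀ z ∈ Z, ∀ x ∈ us, z ≠ x)
    (V : Finset ℂ) (hV : V ⊆ Z) (z : ℂ) (hz : z ∈ Z) (hzV : z ∉ V) :
    Dr c t us z false false (Xs c t Ω us V) =
      ((∏ x ∈ V, ff c x z) * (lam 1 z * prodFF c [z] us)) • Xs c t Ω us V +
      ∑ k ∈ V, (gg c z k * (lam 1 k * prodFF c [k] us) * ∏ x ∈ V.erase k, gg c x k) •
        Dr c t us z false true (Xs c t Ω us (V.erase k)) := by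
  have h := (Dr_AB hc ht us hZ hZu).AC V hV z hz hzV (Om Ω us)
  rw [Dr_Om_22 hw z us (hZu z hz), map_smul, smul_smul] at h
  unfold Xs
  rw [h]
  congr 1
  refine Finset.sum_congr rfl fun k hk => ?_
  rw [Dr_Om_22 hw k us (hZu k (hV hk)), map_smul, map_smul, smul_smul]
  congr 1
  ring

lemma Xs_hd (hc : c ≠ 0) (ht : IsTFam c p21 t) (hw : HW t lam Ω) (u0 : ℂ) (us : List ℂ)
    (hZ : ∀ z ∈ Z, ∀ w ∈ Z, z ≠ w → Nice c z w) (hZu : ∀ z ∈ Z, ∀ x ∈ u0 :: us, z ≠ x)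
    (V : Finset ℂ) (hV : V ⊆ Z) :
    hd false (Xs c t Ω (u0 :: us) V) = Xs c t Ω us V ∧
    hd true (Xs c t Ω (u0 :: us) V) = ∑ k ∈ V, ((lam 1 k * prodFF c [k] us) * gg c k u0 *
      ∏ x ∈ V.erase k, gg c x k) • Xs c t Ω us (V.erase k) := by
  have hZu' : ∀ z ∈ Z, ∀ x ∈ us, z ≠ x := fun z hz x hx => hZu z hz x (by simp [hx])
  have h1 := Dr_AB hc ht (u0 :: us) hZ hZu
  have h0 := Dr_AB hc ht us hZ hZu'
  induction V using Finset.induction_on with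
  | empty => simp [Xs, Cs_empty, hd_Om_false, hd_Om_true]
  | insert w V hwV ih =>
    have hwZ : w ∈ Z := hV (by simp)
    have hVZ : V ⊆ Z := fun x hx => hV (by simp [hx])
    obtain ⟨ih0, ih1⟩ := ih hVZ
    have ne : ∏ x ∈ V, hh c x w ≠ 0 := Finset.prod_ne_zero_iff.2 fun x hx =>
      (hZ x (hVZ hx) w hwZ (fun e => hwV (e ▸ hx))).hh_ne hc
    have e1 : Xs c t Ω (u0 :: us) (insert w V) = (∏ x ∈ V, hh c x w)⁻¹ •
        stp c u0 w (Dr c t us w) false true (Xs c t Ω (u0 :: us) V) := by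
      have := h1.ins hwV hwZ hVZ (Om Ω (u0 :: us))
      rw [eq_inv_smul_iff₀ ne]
      exact this.symm
    have e0 : Xs c t Ω us (insert w V) = (∏ x ∈ V, hh c x w)⁻¹ •
        Dr c t us w false true (Xs c t Ω us V) := by
      have := h0.ins hwV hwZ hVZ (Om Ω us)
      rw [eq_inv_smul_iff₀ ne]
      exact this.symm
    constructor
    · rw [e1, e0, map_smul, hd_stp, ih0]; simp
    · rw [e1, map_smul, hd_stp, Yop_apply, ih0, Xs_A hc ht hw us hZ hZu' V hVZ w hwZ hwV, ih1,
        Finset.sum_insert hwV, Finset.erase_insert hwV]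
      have e2 : (∏ x ∈ V, ff c x w) = (∏ x ∈ V, gg c x w) * ∏ x ∈ V, hh c x w := by
        rw [← Finset.prod_mul_distrib]
        exact Finset.prod_congr rfl fun x hx => gh hc (fun e => hwV (e ▸ hx))
      have e3 : ∀ k ∈ V, ((lam 1 k * prodFF c [k] us) * gg c k u0 *
            ∏ x ∈ (insert w V).erase k, gg c x k) • Xs c t Ω us ((insert w V).erase k) =
          (∏ x ∈ V, hh c x w)⁻¹ • (
            (gg c w u0 - 1) • Dr c t us w false true (((lam 1 k * prodFF c [k] us) * gg c k u0 *
              ∏ x ∈ V.erase k, gg c x k) • Xs c t Ω us (V.erase k)) + 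
            gg c w u0 • (gg c w k * (lam 1 k * prodFF c [k] us) * ∏ x ∈ V.erase k, gg c x k) •
        Dr c t us w false true (Xs c t Ω us (V.erase k))) := by
        intro k hk
        have hkw : k ≠ w := fun e => hwV (e ▸ hk)
        have hwk : w ∉ V.erase k := fun hx => hwV (Finset.mem_of_mem_erase hx)
        have hVk : V.erase k ⊆ Z := fun x hx => hVZ (Finset.mem_of_mem_erase hx)
        rw [Finset.erase_insert_of_ne hkw.symm, Finset.prod_insert hwk]
        have ne' : ∏ x ∈ V.erase k, hh c x w ≠ 0 := Finset.prod_ne_zero_iff.2 fun x hx =>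
          (hZ x (hVk hx) w hwZ (fun e => hwk (e ▸ hx))).hh_ne hc
        have e4 : ∏ x ∈ V, hh c x w = hh c k w * ∏ x ∈ V.erase k, hh c x w :=
          (Finset.mul_prod_erase V _ hk).symm
        have nk := (hZ k (hVZ hk) w hwZ hkw).hh_ne hc
        have e5 : Xs c t Ω us (insert w (V.erase k)) = (∏ x ∈ V.erase k, hh c x w)⁻¹ •
            Dr c t us w false true (Xs c t Ω us (V.erase k)) := by
          have := h0.ins hwk hwZ hVk (Om Ω us)
          rw [eq_inv_smul_iff₀ ne']
          exact this.symm
        have i3 := sub_ne_zero.2 hkw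
        have i4 := sub_ne_zero.2 hkw.symm
        have i5 := sub_ne_zero.2 (hZu w hwZ u0 (by simp))
        have i6 := sub_ne_zero.2 (hZu k (hVZ hk) u0 (by simp))
        have i7 := (hZ k (hVZ hk) w hwZ hkw).2.1
        simp only [map_smul, e5, e4, mul_inv]
        generalize (∏ x ∈ V.erase k, hh c x w)⁻¹ = p
        generalize (∏ x ∈ V.erase k, gg c x k) = q
        generalize prodFF c [k] us = r
        match_scalars
        simp only [ff, gg, hh]
        field_simp
        ring1
      rw [Finset.sum_congr rfl e3, ← Finset.smul_sum, Finset.sum_add_distrib, e2]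
      simp only [map_smul, map_sum, ← Finset.smul_sum]
      simp only [sgn_true, Bool.and_true, Bool.xor_true, Bool.not_false, if_true, sgn_false]
      match_scalars <;> field_simp
      ring1

end Nested7


section Weights

variable {c : ℂ} {lam2 : ℂ → ℂ}

/-- product of `h` over ordered pairs of distinct elements -/
def HHs (c : ℂ) (S : Finset ℂ) : ℂ := ∏ s ∈ S, ∏ s' ∈ S.erase s, hh c s s'

lemma HHs_insert {j : ℂ} {S : Finset ℂ} (hj : j ∉ S) :
    HHs c (insert j S) = (∏ s ∈ S, hh c j s) * (∏ s ∈ S, hh c s j) * HHs c S := by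
  unfold HHs
  have e : (∏ s ∈ S, ∏ s' ∈ (insert j S).erase s, hh c s s') =
      (∏ s ∈ S, hh c s j) * ∏ s ∈ S, ∏ s' ∈ S.erase s, hh c s s' := by
    rw [← Finset.prod_mul_distrib]
    refine Finset.prod_congr rfl fun s hs => ?_
    have hjs : j ≠ s := fun e => hj (e ▸ hs)
    rw [Finset.erase_insert_of_ne hjs, Finset.prod_insert (fun h => hj (Finset.mem_of_mem_erase h))]
  rw [Finset.prod_insert hj, Finset.erase_insert hj, e, mul_assoc]

/-- coefficient of a term of the Bethe vector -/
def Wt (c : ℂ) (lam2 : ℂ → ℂ) (S R Q P : Finset ℂ) : ℂ :=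
  (∏ q ∈ Q, ∏ s ∈ S, gg c q s) * (∏ s ∈ S, ∏ r ∈ R, ff c s r) * (∏ p ∈ P, ∏ q ∈ Q, gg c p q) *
    HHs c S * ∏ q ∈ Q, lam2 q

lemma Wt1 {u0 : ℂ} {S R Q P : Finset ℂ} (h : u0 ∉ R) :
    Wt c lam2 S (insert u0 R) Q P = Wt c lam2 S R Q P * ∏ s ∈ S, ff c s u0 := by
  have e : (∏ s ∈ S, ∏ r ∈ insert u0 R, ff c s r) =
      (∏ s ∈ S, ff c s u0) * ∏ s ∈ S, ∏ r ∈ R, ff c s r := by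
    rw [← Finset.prod_mul_distrib]
    exact Finset.prod_congr rfl fun s _ => Finset.prod_insert h
  unfold Wt
  rw [e]
  ring

lemma Wt2 {u0 : ℂ} {S R Q P : Finset ℂ} (h : u0 ∉ S) :
    Wt c lam2 (insert u0 S) R Q P = Wt c lam2 S R Q P * (∏ s ∈ S, hh c s u0) *
      ((∏ q ∈ Q, gg c q u0) * (∏ r ∈ R, ff c u0 r) * ∏ s ∈ S, hh c u0 s) := by
  have e : (∏ q ∈ Q, ∏ s ∈ insert u0 S, gg c q s) =
      (∏ q ∈ Q, gg c q u0) * ∏ q ∈ Q, ∏ s ∈ S, gg c q s := by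
    rw [← Finset.prod_mul_distrib]
    exact Finset.prod_congr rfl fun s _ => Finset.prod_insert h
  unfold Wt
  rw [e, Finset.prod_insert h, HHs_insert h]
  ring

lemma Wt3 (hc : c ≠ 0) {u0 j : ℂ} {S R Q P : Finset ℂ} (hj : j ∉ S) (hR : j ∈ R) :
    Wt c lam2 (insert j S) (R.erase j) Q P * (gg c u0 j * ∏ s ∈ S, gg c s j) * (∏ s ∈ S, hh c s u0) =
    Wt c lam2 S R Q P * (∏ s ∈ S, hh c s u0) *
      (gg c u0 j * (∏ q ∈ Q, gg c q j) * (∏ r ∈ R.erase j, ff c j r) * ∏ s ∈ S, hh c j s) := by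
  have e : (∏ s ∈ S, ∏ r ∈ R, ff c s r) = (∏ s ∈ S, gg c s j) * (∏ s ∈ S, hh c s j) *
      ∏ s ∈ S, ∏ r ∈ R.erase j, ff c s r := by
    rw [← Finset.prod_mul_distrib, ← Finset.prod_mul_distrib]
    refine Finset.prod_congr rfl fun s hs => ?_
    rw [← Finset.mul_prod_erase R _ hR, gh hc (x := s) (y := j) (fun e => hj (e ▸ hs))]
  rw [Wt2 hj]
  unfold Wt
  rw [e]
  ring

lemma Wt4 (hc : c ≠ 0) {u0 k : ℂ} {U S V Q : Finset ℂ} (hS : S ⊆ U) (hQ : Q ⊆ V) (hk : k ∈ Q)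
    (hVU : ∀ x ∈ V, x ∉ U) :
    (lam2 k * ∏ x ∈ U, ff c k x) * gg c k u0 * (∏ x ∈ V.erase k, gg c x k) *
      Wt c lam2 S (U \ S) (Q.erase k) (V \ Q) * (∏ s ∈ S, hh c s u0) =
    Wt c lam2 S (U \ S) Q (V \ Q) * (∏ s ∈ S, hh c s u0) *
      ((∏ r ∈ U \ S, ff c k r) * (∏ s ∈ S, hh c k s) * gg c k u0 * ∏ q ∈ Q.erase k, gg c q k) := by
  have e1 : (∏ x ∈ U, ff c k x) = (∏ r ∈ U \ S, ff c k r) *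
      ((∏ s ∈ S, gg c k s) * ∏ s ∈ S, hh c k s) := by
    rw [← Finset.prod_sdiff hS, ← Finset.prod_mul_distrib]
    congr 1
    exact Finset.prod_congr rfl fun s hs => gh hc (fun e => hVU k (hQ hk) (e ▸ hS hs))
  have e2 : (∏ x ∈ V.erase k, gg c x k) = (∏ x ∈ V \ Q, gg c x k) * ∏ x ∈ Q.erase k, gg c x k := by
    rw [← Finset.prod_sdiff (Finset.erase_subset_erase k hQ)]
    congr 2
    ext x
    simp only [Finset.mem_sdiff, Finset.mem_erase]
    constructor
    · rintro ⟨⟨h1, h2⟩, h3⟩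
      exact ⟨h2, fun h => h3 ⟨h1, h⟩⟩
    · rintro ⟨h1, h2⟩
      exact ⟨⟨fun e => h2 (e ▸ hk), h1⟩, fun h => h2 h.2⟩
  have e3 : (∏ p ∈ V \ Q, ∏ q ∈ Q, gg c p q) =
      (∏ p ∈ V \ Q, gg c p k) * ∏ p ∈ V \ Q, ∏ q ∈ Q.erase k, gg c p q := by
    rw [← Finset.prod_mul_distrib]
    exact Finset.prod_congr rfl fun p _ => (Finset.mul_prod_erase Q _ hk).symm
  unfold Wt
  rw [e1, e2, e3, ← Finset.mul_prod_erase Q (fun q => ∏ s ∈ S, gg c q s) hk,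
    ← Finset.mul_prod_erase Q lam2 hk]
  ring

end Weights

section Reindex

variable {M : Type*} [AddCommGroup M]

lemma reidx1 (U : Finset ℂ) (F : Finset ℂ → ℂ → M) :
    ∑ S ∈ U.powerset, ∑ j ∈ S, F S j = ∑ S ∈ U.powerset, ∑ j ∈ U \ S, F (insert j S) j := by
  rw [Finset.sum_sigma', Finset.sum_sigma']
  refine Finset.sum_bij' (fun p _ => ⟨p.1.erase p.2, p.2⟩) (fun p _ => ⟨insert p.2 p.1, p.2⟩)
    ?_ ?_ ?_ ?_ ?_
  · rintro ⟨S, j⟩ h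
    simp only [Finset.mem_sigma, Finset.mem_powerset, Finset.mem_sdiff, Finset.mem_erase] at h ⊢
    exact ⟨(Finset.erase_subset _ _).trans h.1, h.1 h.2, fun hh => hh.1 rfl⟩
  · rintro ⟨S, j⟩ h
    simp only [Finset.mem_sigma, Finset.mem_powerset, Finset.mem_sdiff] at h ⊢
    exact ⟨Finset.insert_subset h.2.1 h.1, Finset.mem_insert_self _ _⟩
  · rintro ⟨S, j⟩ h
    simp only [Finset.mem_sigma] at h
    simp [Finset.insert_erase h.2]
  · rintro ⟨S, j⟩ h
    simp only [Finset.mem_sigma, Finset.mem_sdiff] at h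
    simp [Finset.erase_insert h.2.2]
  · rintro ⟨S, j⟩ h
    simp only [Finset.mem_sigma] at h
    simp [Finset.insert_erase h.2]

lemma reidx2 (V : Finset ℂ) (G : ℂ → Finset ℂ → M) :
    ∑ k ∈ V, ∑ Q ∈ (V.erase k).powerset, G k Q = ∑ Q ∈ V.powerset, ∑ k ∈ Q, G k (Q.erase k) := by
  rw [Finset.sum_sigma', Finset.sum_sigma']
  refine Finset.sum_bij' (fun p _ => ⟨insert p.1 p.2, p.1⟩) (fun p _ => ⟨p.2, p.1.erase p.2⟩)
    ?_ ?_ ?_ ?_ ?_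
  · rintro ⟨k, Q⟩ h
    simp only [Finset.mem_sigma, Finset.mem_powerset] at h ⊢
    exact ⟨Finset.insert_subset h.1 (h.2.trans (Finset.erase_subset _ _)), Finset.mem_insert_self _ _⟩
  · rintro ⟨Q, k⟩ h
    simp only [Finset.mem_sigma, Finset.mem_powerset] at h ⊢
    exact ⟨h.1 h.2, Finset.erase_subset_erase _ h.1⟩
  · rintro ⟨k, Q⟩ h
    simp only [Finset.mem_sigma, Finset.mem_powerset] at h
    have : k ∉ Q := fun hk => (Finset.mem_erase.1 (h.2 hk)).1 rfl
    simp [Finset.erase_insert this]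
  · rintro ⟨Q, k⟩ h
    simp only [Finset.mem_sigma] at h
    simp [Finset.insert_erase h.2]
  · rintro ⟨k, Q⟩ h
    simp only [Finset.mem_sigma, Finset.mem_powerset] at h
    have : k ∉ Q := fun hk => (Finset.mem_erase.1 (h.2 hk)).1 rfl
    simp [Finset.erase_insert this]

end Reindex

section PhiRec

variable {M : Type*} [AddCommGroup M] [Module ℂ M]
variable {c : ℂ} {lam2 : ℂ → ℂ} {Z : Finset ℂ} {A B : ℂ → Module.End ℂ M}

/-- product of commuting operators over a finite set -/
def PP (A : ℂ → Module.End ℂ M) (R : Finset ℂ) : Module.End ℂ M := Tprod A R.toList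

lemma Tprod_perm (hA : ∀ z ∈ Z, ∀ w ∈ Z, Commute (A z) (A w)) {l l' : List ℂ} (hp : l.Perm l')
    (hl : ∀ x ∈ l, x ∈ Z) : Tprod A l = Tprod A l' := by
  refine (hp.map A).prod_eq' ?_
  rw [List.pairwise_map]
  exact List.pairwise_of_forall_mem_list fun x hx y hy => hA x (hl x hx) y (hl y hy)

lemma PP_insert (hA : ∀ z ∈ Z, ∀ w ∈ Z, Commute (A z) (A w)) {j : ℂ} {R : Finset ℂ} (hj : j ∉ R)
    (hjZ : j ∈ Z) (hR : R ⊆ Z) (x : M) : PP A (insert j R) x = A j (PP A R x) := by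
  unfold PP
  rw [Tprod_perm hA (Finset.toList_insert hj)
    (fun x hx => Finset.insert_subset hjZ hR (Finset.mem_toList.1 hx))]
  simp [Tprod]

/-- the Bethe vector in set form -/
def PhF (c : ℂ) (lam2 : ℂ → ℂ) (A B : ℂ → Module.End ℂ M) (E : Finset ℂ → M) (U V : Finset ℂ) : M :=
  ∑ S ∈ U.powerset, ∑ Q ∈ V.powerset,
    if S.card = Q.card then Wt c lam2 S (U \ S) Q (V \ Q) • Cs c B S (PP A (U \ S) (E (V \ Q))) else 0

lemma PhF_rec (h : ABrel c Z A B) (hA : ∀ z ∈ Z, ∀ w ∈ Z, Commute (A z) (A w))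
    (E : Finset ℂ → M) {u0 : ℂ} {U V : Finset ℂ} (hu0 : u0 ∈ Z) (hU : U ⊆ Z) (huU : u0 ∉ U)
    (hVU : ∀ x ∈ V, x ∉ U) (hVu : u0 ∉ V) :
    PhF c lam2 A B E (insert u0 U) V = A u0 (PhF c lam2 A B E U V) +
      B u0 (∑ k ∈ V, ((lam2 k * ∏ x ∈ U, ff c k x) * gg c k u0 * ∏ x ∈ V.erase k, gg c x k) •
        PhF c lam2 A B E U (V.erase k)) := by
  have hc := h.c0
  -- first part of the right-hand side
  have r1 : A u0 (PhF c lam2 A B E U V) =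
      (∑ S ∈ U.powerset, ∑ Q ∈ V.powerset, if S.card = Q.card then
        Wt c lam2 S (insert u0 U \ S) Q (V \ Q) • Cs c B S (PP A (insert u0 U \ S) (E (V \ Q))) else 0) +
      ∑ Q ∈ V.powerset, ∑ S ∈ U.powerset, ∑ j ∈ S, if S.card = Q.card then
        (Wt c lam2 S (U \ S) Q (V \ Q) * (gg c u0 j * ∏ x ∈ S.erase j, gg c x j)) •
          B u0 (Cs c B (S.erase j) (A j (PP A (U \ S) (E (V \ Q))))) else 0 := by
    rw [Finset.sum_comm (s := V.powerset), ← Finset.sum_add_distrib]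
    unfold PhF
    rw [map_sum]
    refine Finset.sum_congr rfl fun S hS => ?_
    rw [map_sum, ← Finset.sum_add_distrib]
    refine Finset.sum_congr rfl fun Q hQ => ?_
    have hSU := Finset.mem_powerset.1 hS
    have huS : u0 ∉ S := fun hx => huU (hSU hx)
    split_ifs with hcard
    · rw [map_smul, h.AC S (hSU.trans hU) u0 hu0 huS, Finset.insert_sdiff_of_notMem _ huS,
        PP_insert hA (fun hx => huU (Finset.mem_sdiff.1 hx).1) hu0 (Finset.sdiff_subset.trans hU),
        Wt1 (fun hx => huU (Finset.mem_sdiff.1 hx).1), smul_add, smul_smul, Finset.smul_sum]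
      simp only [smul_smul]
    · simp
  have r2 : (∑ Q ∈ V.powerset, ∑ S ∈ U.powerset, ∑ j ∈ S, if S.card = Q.card then
        (Wt c lam2 S (U \ S) Q (V \ Q) * (gg c u0 j * ∏ x ∈ S.erase j, gg c x j)) •
          B u0 (Cs c B (S.erase j) (A j (PP A (U \ S) (E (V \ Q))))) else 0) =
      ∑ Q ∈ V.powerset, ∑ S ∈ U.powerset, ∑ j ∈ U \ S, if S.card + 1 = Q.card then
        (Wt c lam2 S (U \ S) Q (V \ Q) * (∏ s ∈ S, hh c s u0) *
          (gg c u0 j * (∏ q ∈ Q, gg c q j) * (∏ r ∈ (U \ S).erase j, ff c j r) * ∏ s ∈ S, hh c j s)) •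
        Cs c B (insert u0 S) (PP A (U \ S) (E (V \ Q))) else 0 := by
    refine Finset.sum_congr rfl fun Q hQ => ?_
    rw [reidx1]
    refine Finset.sum_congr rfl fun S hS => ?_
    refine Finset.sum_congr rfl fun j hj => ?_
    have hSU := Finset.mem_powerset.1 hS
    have huS : u0 ∉ S := fun hx => huU (hSU hx)
    have hj' := Finset.mem_sdiff.1 hj
    rw [Finset.card_insert_of_notMem hj'.2]
    split_ifs with hcard
    · have e : U \ insert j S = (U \ S).erase j := by
        ext x; simp only [Finset.mem_sdiff, Finset.mem_insert, Finset.mem_erase]; tauto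
      rw [e, Finset.erase_insert hj'.2, ← PP_insert hA (Finset.notMem_erase _ _) (hU hj'.1)
        (((Finset.erase_subset _ _).trans Finset.sdiff_subset).trans hU), Finset.insert_erase hj,
        h.ins huS hu0 (hSU.trans hU), smul_smul, Wt3 hc hj'.2 hj]
    · rfl
  have r3 : B u0 (∑ k ∈ V, ((lam2 k * ∏ x ∈ U, ff c k x) * gg c k u0 * ∏ x ∈ V.erase k, gg c x k) •
        PhF c lam2 A B E U (V.erase k)) =
      ∑ Q ∈ V.powerset, ∑ S ∈ U.powerset, ∑ k ∈ Q, if S.card + 1 = Q.card then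
        (Wt c lam2 S (U \ S) Q (V \ Q) * (∏ s ∈ S, hh c s u0) *
          ((∏ r ∈ U \ S, ff c k r) * (∏ s ∈ S, hh c k s) * gg c k u0 * ∏ q ∈ Q.erase k, gg c q k)) •
        Cs c B (insert u0 S) (PP A (U \ S) (E (V \ Q))) else 0 := by
    unfold PhF
    have : ∀ k ∈ V, ((lam2 k * ∏ x ∈ U, ff c k x) * gg c k u0 * ∏ x ∈ V.erase k, gg c x k) •
        (∑ S ∈ U.powerset, ∑ Q ∈ (V.erase k).powerset,
          if S.card = Q.card then Wt c lam2 S (U \ S) Q (V.erase k \ Q) •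
            Cs c B S (PP A (U \ S) (E (V.erase k \ Q))) else 0) =
        ∑ Q ∈ (V.erase k).powerset, ∑ S ∈ U.powerset,
          if S.card = Q.card then ((lam2 k * ∏ x ∈ U, ff c k x) * gg c k u0 *
            (∏ x ∈ V.erase k, gg c x k) * Wt c lam2 S (U \ S) Q (V.erase k \ Q)) •
            Cs c B S (PP A (U \ S) (E (V.erase k \ Q))) else 0 := by
      intro k hk
      rw [Finset.sum_comm, Finset.smul_sum]
      refine Finset.sum_congr rfl fun Q _ => ?_
      rw [Finset.smul_sum]
      refine Finset.sum_congr rfl fun S _ => ?_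
      split_ifs
      · rw [smul_smul]
      · rw [smul_zero]
    rw [Finset.sum_congr rfl this, reidx2 V (fun k Q => ∑ S ∈ U.powerset,
          if S.card = Q.card then ((lam2 k * ∏ x ∈ U, ff c k x) * gg c k u0 *
            (∏ x ∈ V.erase k, gg c x k) * Wt c lam2 S (U \ S) Q (V.erase k \ Q)) •
            Cs c B S (PP A (U \ S) (E (V.erase k \ Q))) else 0), map_sum]
    refine Finset.sum_congr rfl fun Q hQ => ?_
    rw [Finset.sum_comm, map_sum]
    refine Finset.sum_congr rfl fun S hS => ?_
    rw [map_sum]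
    refine Finset.sum_congr rfl fun k hk => ?_
    have hQV := Finset.mem_powerset.1 hQ
    have hSU := Finset.mem_powerset.1 hS
    have huS : u0 ∉ S := fun hx => huU (hSU hx)
    have e : V.erase k \ Q.erase k = V \ Q := by
      ext x
      simp only [Finset.mem_sdiff, Finset.mem_erase]
      constructor
      · rintro ⟨⟨h1, h2⟩, h3⟩
        exact ⟨h2, fun h => h3 ⟨h1, h⟩⟩
      · rintro ⟨h1, h2⟩
        exact ⟨⟨fun e => h2 (e ▸ hk), h1⟩, fun h => h2 h.2⟩
    have hcard : (S.card = (Q.erase k).card) ↔ (S.card + 1 = Q.card) := by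
      rw [← Finset.card_erase_add_one hk]; omega
    simp only [hcard, e]
    split_ifs
    · rw [map_smul, h.ins huS hu0 (hSU.trans hU), smul_smul, Wt4 hc hSU hQV hk hVU]
    · simp
  have l1 : PhF c lam2 A B E (insert u0 U) V =
      (∑ S ∈ U.powerset, ∑ Q ∈ V.powerset, if S.card = Q.card then
        Wt c lam2 S (insert u0 U \ S) Q (V \ Q) • Cs c B S (PP A (insert u0 U \ S) (E (V \ Q))) else 0) +
      ∑ Q ∈ V.powerset, ∑ S ∈ U.powerset, if S.card + 1 = Q.card then
        Wt c lam2 (insert u0 S) (U \ S) Q (V \ Q) •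
          Cs c B (insert u0 S) (PP A (U \ S) (E (V \ Q))) else 0 := by
    unfold PhF
    rw [Finset.sum_powerset_insert huU]
    congr 1
    rw [Finset.sum_comm]
    refine Finset.sum_congr rfl fun Q hQ => Finset.sum_congr rfl fun S hS => ?_
    have hSU := Finset.mem_powerset.1 hS
    have huS : u0 ∉ S := fun hx => huU (hSU hx)
    have e : insert u0 U \ insert u0 S = U \ S := by
      ext x
      simp only [Finset.mem_sdiff, Finset.mem_insert]
      constructor
      · rintro ⟨h1 | h1, h2⟩
        · exact absurd (Or.inl h1) h2
        · exact ⟨h1, fun h => h2 (Or.inr h)⟩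
      · rintro ⟨h1, h2⟩
        refine ⟨Or.inr h1, ?_⟩
        rintro (rfl | h3)
        · exact huU h1
        · exact h2 h3
    rw [Finset.card_insert_of_notMem huS, e]
  rw [l1, r1, r2, r3, add_assoc, ← Finset.sum_add_distrib]
  congr 1
  refine Finset.sum_congr rfl fun Q hQ => ?_
  rw [← Finset.sum_add_distrib]
  refine Finset.sum_congr rfl fun S hS => ?_
  have hQV := Finset.mem_powerset.1 hQ
  have hSU := Finset.mem_powerset.1 hS
  have huS : u0 ∉ S := fun hx => huU (hSU hx)
  split_ifs with hcard
  · rw [← Finset.sum_smul, ← Finset.sum_smul, ← Finset.mul_sum, ← Finset.mul_sum, ← add_smul,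
      ← mul_add, Wt2 huS, pf1 hc Q S (by omega) (U \ S)
        (fun r hr hq => hVU r (hQV hq) (Finset.mem_sdiff.1 hr).1) u0 (fun hx => hVu (hQV hx))
        (fun hx => huU (Finset.mem_sdiff.1 hx).1), add_comm]
  · simp

end PhiRec

instance Nice.instSymm {c : ℂ} : Std.Symm (Nice c) := ⟨fun _ _ h => Nice.symm h⟩


section Link

variable {M : Type*} [AddCommGroup M] [Module ℂ M]
variable {c : ℂ} {t : Fin 3 → Fin 3 → ℂ → Module.End ℂ M}
variable {lam : Fin 3 → ℂ → ℂ} {Ω : M} {Z : Finset ℂ}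

lemma t_AB (hc : c ≠ 0) (ht : IsTFam c p21 t)
    (hZ : ∀ z ∈ Z, ∀ w ∈ Z, z ≠ w → Nice c z w) : ABrel c Z (t 0 1) (t 0 2) where
  c0 := hc
  nice := hZ
  ab := by
    intro z hz w hw hzw x
    have h1 := cr_cr ht true false hzw x
    have e : gg c w z = - gg c z w := by
      have n1 := sub_ne_zero.2 hzw
      have n2 := sub_ne_zero.2 hzw.symm
      unfold gg; field_simp; ring
    simp only [ix_true, ix_false, Bool.and_false, sgn_false, one_smul, e] at h1
    linear_combination (norm := module) (-1 : ℂ) • h1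
  bb := by
    intro z hz w hw hzw x
    have h1 := cr_cr ht true true hzw x
    have n1 := sub_ne_zero.2 hzw
    have n2 := sub_ne_zero.2 hzw.symm
    simp only [ix_true, Bool.and_true, sgn_true] at h1
    linear_combination (norm := skip) ((w - z) / c) • h1
    match_scalars
    · simp only [ff, hh, gg]; field_simp; try ring1
    · simp only [ff, hh, gg]; field_simp; try ring1

lemma t_comm (ht : IsTFam c p21 t) (hZ : ∀ z ∈ Z, ∀ w ∈ Z, z ≠ w → Nice c z w) :
    ∀ z ∈ Z, ∀ w ∈ Z, Commute (t 0 1 z) (t 0 1 w) := by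
  intro z hz w hw
  by_cases hzw : z = w
  · subst hzw; exact Commute.refl _
  have hn := hZ z hz w hw hzw
  refine LinearMap.ext fun x => ?_
  change t 0 1 z (t 0 1 w x) = t 0 1 w (t 0 1 z x)
  have h1 := cr_cr ht false false (z := z) (u := w) hzw x
  have e : ff c w z = 1 + gg c w z := by
    have n2 := sub_ne_zero.2 (Ne.symm hzw)
    unfold ff gg; field_simp
  have h2 : ff c w z • t 0 1 w (t 0 1 z x) = ff c w z • t 0 1 z (t 0 1 w x) := by
    rw [ix_false] at h1
    rw [h1, e]
    simp only [Bool.and_false, sgn_false]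
    module
  exact (smul_right_injective M hn.symm.ff_ne h2).symm

lemma TT_pt (l : List ℂ) (w : List Bool) :
    TT c (fun z => Dr c t [] z false true) l (Om Ω []) w = TT c (t 1 2) l Ω := by
  induction l with
  | nil => rw [TT_nil, TT_nil]; rfl
  | cons x l ih =>
    rw [TT_cons, TT_cons, ← ih]
    rfl

lemma TT23_list (hc : c ≠ 0) (ht : IsTFam c p21 t) 
    (hZ : ∀ z ∈ Z, ∀ w ∈ Z, z ≠ w → Nice c z w) {l : List ℂ} (hn : l.Nodup) (hl : ∀ x ∈ l, x ∈ Z) :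
    TT c (t 1 2) l Ω = Cs c (t 1 2) l.toFinset Ω := by
  have h := (Dr_AB hc ht [] hZ (by simp)).list hn hl (Om Ω [])
  have h1 := congrFun h []
  rw [TT_pt] at h1
  rw [h1, Cs, TT_pt, Cs]

lemma PhF_empty {lam2 : ℂ → ℂ} {A B : ℂ → Module.End ℂ M} (E : Finset ℂ → M) (V : Finset ℂ) :
    PhF c lam2 A B E ∅ V = E V := by
  unfold PhF
  rw [Finset.powerset_empty, Finset.sum_singleton, Finset.sum_eq_single ∅]
  · simp [Wt, HHs, Cs_empty, PP, Tprod]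
  · intro Q _ hQ
    rw [if_neg]
    intro h
    exact hQ (Finset.card_eq_zero.1 (by simpa using h.symm))
  · simp

lemma prodFF_set (k : ℂ) {us : List ℂ} (h : us.Nodup) :
    prodFF c [k] us = ∏ x ∈ us.toFinset, ff c k x := by
  rw [List.prod_toFinset _ h]
  simp [prodFF]

/-- nested form and explicit form of the Bethe vector agree -/
lemma BB_PhF (hc : c ≠ 0) (ht : IsTFam c p21 t) (hw : HW t lam Ω)
    (hZ : ∀ z ∈ Z, ∀ w ∈ Z, z ≠ w → Nice c z w) : ∀ us : List ℂ, us.Pairwise (Nice c) →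
    (∀ x ∈ us, ∀ z ∈ Z, z ≠ x) → ∀ V, V ⊆ Z →
    BB t us (Xs c t Ω us V) =
      PhF c (lam 1) (t 0 1) (t 0 2) (fun W => Cs c (t 1 2) W Ω) us.toFinset V := by
  intro us
  induction us with
  | nil =>
    intro _ _ V _
    rw [List.toFinset_nil, PhF_empty, BB_nil]
    exact TT_pt V.toList []
  | cons u0 us ih =>
    intro hus hxz V hV
    have hnd : (u0 :: us).Nodup := hus.imp fun h => h.1
    have hni : ∀ z ∈ (u0 :: us).toFinset, ∀ w ∈ (u0 :: us).toFinset, z ≠ w → Nice c z w := by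
      intro z hz w hw hzw
      exact List.Pairwise.forall (R := Nice c) hus (List.mem_toFinset.1 hz) (List.mem_toFinset.1 hw) hzw
    have hxz' : ∀ x ∈ us, ∀ z ∈ Z, z ≠ x := fun x hx => hxz x (by simp [hx])
    have ih := ih (List.pairwise_cons.1 hus).2 hxz'
    have hh := Xs_hd hc ht hw u0 us hZ (fun z hz x hx => hxz x hx z hz) V hV
    have hnd' := List.nodup_cons.1 hnd
    rw [BB_cons, hh.1, hh.2, ih V hV, List.toFinset_cons, map_sum]
    rw [List.toFinset_cons] at hni
    rw [PhF_rec (t_AB hc ht hni) (t_comm ht hni) _ (Finset.mem_insert_self _ _)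
      (Finset.subset_insert _ _) (by simpa using hnd'.1)
      (fun x hx hxu => hxz x (by simp [List.mem_toFinset.1 hxu]) x (hV hx) rfl)
      (fun hx => hxz u0 (by simp) u0 (hV hx) rfl)]
    congr 2
    refine Finset.sum_congr rfl fun k hk => ?_
    rw [map_smul, ih _ ((Finset.erase_subset _ _).trans hV), prodFF_set k hnd'.2]

end Link

section Convert

variable {M : Type*} [AddCommGroup M] [Module ℂ M]
variable {c : ℂ} {t : Fin 3 → Fin 3 → ℂ → Module.End ℂ M}
variable {lam : Fin 3 → ℂ → ℂ} {Ω : M} {Z : Finset ℂ}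

lemma sel_nodup {l : List ℂ} (h : l.Nodup) (S : Finset (Fin l.length)) : (sel l S).Nodup := by
  unfold sel
  exact (Finset.sort_nodup _ _).map (List.nodup_iff_injective_get.1 h)

lemma sel_toFinset (l : List ℂ) (S : Finset (Fin l.length)) :
    (sel l S).toFinset = S.image l.get := by
  ext x
  simp [sel]

lemma sel_compl {l : List ℂ} (h : l.Nodup) (S : Finset (Fin l.length)) :
    (sel l Sᶜ).toFinset = l.toFinset \ S.image l.get := by
  have hi := List.nodup_iff_injective_get.1 h
  rw [sel_toFinset]
  ext x
  simp only [Finset.mem_image, Finset.mem_compl, Finset.mem_sdiff, List.mem_toFinset]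
  constructor
  · rintro ⟨j, hj, rfl⟩
    refine ⟨List.get_mem _ _, ?_⟩
    rintro ⟨k, hk, e⟩
    exact hj (hi e ▸ hk)
  · rintro ⟨hx, hn⟩
    obtain ⟨j, rfl⟩ := List.get_of_mem hx
    exact ⟨j, fun hj => hn ⟨j, hj, rfl⟩, rfl⟩

lemma sum_sel {l : List ℂ} (h : l.Nodup) (F : Finset ℂ → M) :
    ∑ S : Finset (Fin l.length), F (S.image l.get) = ∑ S ∈ l.toFinset.powerset, F S := by
  have hi := List.nodup_iff_injective_get.1 h
  refine Finset.sum_nbij (fun S => S.image l.get) ?_ ?_ ?_ ?_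
  · intro S _
    rw [Finset.mem_powerset]
    intro x hx
    obtain ⟨j, _, rfl⟩ := Finset.mem_image.1 hx
    exact List.mem_toFinset.2 (List.get_mem _ _)
  · exact (Finset.image_injective hi).injOn
  · intro S hS
    have hS' : S ⊆ l.toFinset := Finset.mem_powerset.1 hS
    refine ⟨Finset.univ.filter fun j => l.get j ∈ S, by simp, ?_⟩
    ext x
    simp only [Finset.mem_image, Finset.mem_filter, Finset.mem_univ, true_and]
    constructor
    · rintro ⟨j, hj, rfl⟩; exact hj
    · intro hx
      obtain ⟨j, rfl⟩ := List.get_of_mem (List.mem_toFinset.1 (hS' hx))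
      exact ⟨j, hx, rfl⟩
  · intros; rfl

lemma prod2_set (F : ℂ → ℂ → ℂ) {l l' : List ℂ} (h : l.Nodup) (h' : l'.Nodup) :
    (l.map fun x => (l'.map fun y => F x y).prod).prod = ∏ x ∈ l.toFinset, ∏ y ∈ l'.toFinset, F x y := by
  rw [List.prod_toFinset _ h]
  simp only [List.prod_toFinset _ h']

lemma prod_get {l : List ℂ} (h : l.Nodup) (F : ℂ → ℂ) :
    ∏ x ∈ l.toFinset, F x = ∏ j : Fin l.length, F (l.get j) := by
  rw [List.prod_toFinset _ h, ← List.prod_ofFn]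
  congr 1
  conv_lhs => rw [← List.ofFn_get l]
  rw [List.map_ofFn]
  rfl

lemma prodHHne_set {l : List ℂ} (h : l.Nodup) : prodHHne c l = HHs c l.toFinset := by
  have hi := List.nodup_iff_injective_get.1 h
  unfold prodHHne HHs
  rw [prod_get h]
  refine Finset.prod_congr rfl fun j _ => ?_
  have e : l.toFinset.erase (l.get j) = l.toFinset.filter fun x => l.get j ≠ x := by
    ext x; simp only [Finset.mem_erase, Finset.mem_filter]; tauto
  rw [e, Finset.prod_filter, prod_get h]
  refine Finset.prod_congr rfl fun k _ => ?_
  have : (j ≠ k) ↔ (l.get j ≠ l.get k) := hi.ne_iff.symm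
  simp only [this]

lemma PhiA_PhF (hc : c ≠ 0) (ht : IsTFam c p21 t) (lam2 : ℂ → ℂ) (u v : List ℂ)
    (hu : u.Pairwise (Nice c)) (hv : v.Pairwise (Nice c)) :
    PhiA c t lam2 u v Ω =
      PhF c lam2 (t 0 1) (t 0 2) (fun W => Cs c (t 1 2) W Ω) u.toFinset v.toFinset := by
  have hun : u.Nodup := hu.imp fun h => h.1
  have hvn : v.Nodup := hv.imp fun h => h.1
  have hnu : ∀ z ∈ u.toFinset, ∀ w ∈ u.toFinset, z ≠ w → Nice c z w := by
    intro z hz w hw hzw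
    exact List.Pairwise.forall (R := Nice c) hu (List.mem_toFinset.1 hz) (List.mem_toFinset.1 hw) hzw
  have hnv : ∀ z ∈ v.toFinset, ∀ w ∈ v.toFinset, z ≠ w → Nice c z w := by
    intro z hz w hw hzw
    exact List.Pairwise.forall (R := Nice c) hv (List.mem_toFinset.1 hz) (List.mem_toFinset.1 hw) hzw
  have hmem : ∀ (l : List ℂ) (S : Finset (Fin l.length)), ∀ x ∈ sel l S, x ∈ l.toFinset := by
    intro l S x hx
    have : x ∈ S.image l.get := by rw [← sel_toFinset]; exact List.mem_toFinset.2 hx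
    obtain ⟨j, _, rfl⟩ := Finset.mem_image.1 this
    exact List.mem_toFinset.2 (List.get_mem _ _)
  unfold PhF
  rw [← sum_sel hun]
  unfold PhiA
  rw [LinearMap.sum_apply]
  refine Finset.sum_congr rfl fun S _ => ?_
  rw [← sum_sel hvn, LinearMap.sum_apply]
  refine Finset.sum_congr rfl fun Q _ => ?_
  rw [Finset.card_image_of_injective _ (List.nodup_iff_injective_get.1 hun),
    Finset.card_image_of_injective _ (List.nodup_iff_injective_get.1 hvn)]
  split_ifs with hcard
  · rw [LinearMap.smul_apply, Module.End.mul_apply, Module.End.mul_apply,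
      TT23_list hc ht hnv (sel_nodup hvn _) (hmem v _),
      (t_AB hc ht hnu).list (sel_nodup hun _) (hmem u _)]
    have e : Tprod (t 0 1) (sel u Sᶜ) = PP (t 0 1) (u.toFinset \ S.image u.get) := by
      unfold PP
      rw [← sel_compl hun]
      exact Tprod_perm (t_comm ht hnu) (List.toFinset_toList (sel_nodup hun _)).symm (hmem u _)
    rw [e, sel_compl hvn, sel_toFinset]
    congr 1
    unfold prodGG prodFF lamP Wt
    rw [prodHHne_set (sel_nodup hun _), prod2_set _ (sel_nodup hvn _) (sel_nodup hun _),
      prod2_set _ (sel_nodup hun _) (sel_nodup hun _),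
      prod2_set _ (sel_nodup hvn _) (sel_nodup hvn _), sel_compl hvn, sel_compl hun,
      ← List.prod_toFinset _ (sel_nodup hvn _), sel_toFinset, sel_toFinset]
  · rfl

lemma PhiA_hom {A A' : Type*} [Ring A] [Algebra ℂ A] [Ring A'] [Algebra ℂ A'] (φ : A →ₐ[ℂ] A')
    (T : Fin 3 → Fin 3 → ℂ → A) (lam2 : ℂ → ℂ) (u v : List ℂ) :
    φ (PhiA c T lam2 u v) = PhiA c (fun i j z => φ (T i j z)) lam2 u v := by
  have h1 : ∀ (B : ℂ → A) l, φ (Tprod B l) = Tprod (fun z => φ (B z)) l := by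
    intro B l
    unfold Tprod
    rw [map_list_prod, List.map_map]
    rfl
  unfold PhiA
  rw [map_sum]
  refine Finset.sum_congr rfl fun S _ => ?_
  rw [map_sum]
  refine Finset.sum_congr rfl fun Q _ => ?_
  split_ifs
  · simp only [map_smul, map_mul, TT, h1]
  · exact map_zero _

end Convert

theorem statement8 {M : Type*} [AddCommGroup M] [Module ℂ M] [Module A M]
    [IsScalarTower ℂ A M]
    (c : ℂ) (hc : c ≠ 0) (T : Fin 3 → Fin 3 → ℂ → A)
    (hT : IsTFam c p21 T) (lam : Fin 3 → ℂ → ℂ) (Ω : M)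
    (hw0 : ∀ i j : Fin 3, j < i → ∀ z : ℂ, T i j z • Ω = 0)
    (hw1 : ∀ i : Fin 3, ∀ z : ℂ, T i i z • Ω = lam i z • Ω)
    (u v : List ℂ) (z : ℂ) (hadm : Admissible c (z :: (u ++ v)))
    (hbetheU : ∀ j : Fin u.length,
        lam 0 (u.get j) * prodFF c (u.eraseIdx (j : ℕ)) [u.get j]
          = lam 1 (u.get j) * prodFF c [u.get j] (u.eraseIdx (j : ℕ)) *
              prodFF c v [u.get j])
    (hbetheV : ∀ j : Fin v.length,
        lam 2 (v.get j) = lam 1 (v.get j) * prodFF c [v.get j] u) :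
    (T 0 0 z + T 1 1 z - T 2 2 z) • (PhiA c T (lam 1) u v • Ω)
      = (lam 0 z * prodFF c u [z]
            + lam 1 z * prodFF c [z] u * prodFF c v [z]
            - lam 2 z * prodFF c v [z]) • (PhiA c T (lam 1) u v • Ω) := by
  have : SMulCommClass A ℂ M := IsScalarTower.to_smulCommClass'
  let φ : A →ₐ[ℂ] Module.End ℂ M := Algebra.lsmul ℂ ℂ M
  let t : Fin 3 → Fin 3 → ℂ → Module.End ℂ M := fun i j z => φ (T i j z)
  have ht : IsTFam c p21 t := by
    intro i j k l z w hzw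
    have := congrArg φ (hT i j k l z w hzw)
    simpa only [map_sub, map_mul, map_smul] using this
  have hw : HW t lam Ω := ⟨hw0, hw1⟩
  change (z :: (u ++ v)).Pairwise (Nice c) at hadm
  rw [List.pairwise_cons, List.pairwise_append] at hadm
  obtain ⟨hz, hu, hv, huv⟩ := hadm
  have hvn : v.Nodup := hv.imp fun h => h.1
  have hnv : ∀ z ∈ v.toFinset, ∀ w ∈ v.toFinset, z ≠ w → Nice c z w := by
    intro z hz w hw hzw
    exact List.Pairwise.forall (R := Nice c) hv (List.mem_toFinset.1 hz) (List.mem_toFinset.1 hw) hzw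
  have hvu : ∀ z ∈ v.toFinset, ∀ x ∈ u, z ≠ x := fun z hz x hx =>
    (huv x hx z (List.mem_toFinset.1 hz)).1.symm
  have hBB : BB t u (XX c t Ω u v) = PhiA c T (lam 1) u v • Ω := by
    have h1 : PhiA c T (lam 1) u v • Ω = PhiA c t (lam 1) u v Ω := by
      rw [← PhiA_hom φ]; rfl
    rw [h1, PhiA_PhF hc ht (lam 1) u v hu hv, XX_TT,
      (Dr_AB hc ht u hnv hvu).list hvn (fun x hx => List.mem_toFinset.2 hx)]
    exact BB_PhF hc ht hw hnv u hu (fun x hx z hz => hvu z hz x hx) v.toFinset (Finset.Subset.refl _)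
  have hE := eigen ht hw u v z hu hv huv (fun x hx => hz x (by simp [hx]))
    (fun y hy => hz y (by simp [hy])) hbetheU (by
      intro y hy
      obtain ⟨j, rfl⟩ := List.get_of_mem hy
      exact hbetheV j)
  rw [hBB] at hE
  rw [sub_smul, add_smul]
  exact hE

end Bethe
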